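/- Let n > 1 and let q₁, q₂ : ℝⁿ → ℝ be smooth functions supported in the closed unit ball B̄. For i = 1,2 suppose uᵢ⁺ is a smooth function on {(x,t) ∈ ℝⁿ×ℝ : t ≥ z} satisfying ∂ₜ²uᵢ⁺ − Δₓuᵢ⁺ + qᵢ·uᵢ⁺ = 0 on the open region {t > z}, the characteristic condition uᵢ⁺(y,z,z) = −(1/2)∫_{−∞}^{z} qᵢ(y,s) ds for all (y,z) ∈ ℝⁿ, and uᵢ⁺(x,t) = 0 whenever z ≤ t < −1; and suppose uᵢ⁻ is a smooth function on {(x,t) : t ≥ −z} satisfying ∂ₜ²uᵢ⁻ − Δₓuᵢ⁻ + qᵢ·uᵢ⁻ = 0 on {t > −z}, uᵢ⁻(y,z,−z) = −(1/2)∫_{z}^{∞} qᵢ(y,s) ds for all (y,z), and uᵢ⁻(x,t) = 0 whenever −z ≤ t < −1. Let T > 6 and set Σ_l = {(y,z,t) : (y,z) ∈ S, t ≤ T, t ≥ z} and Σ_r = {(y,z,t) : (y,z) ∈ S, t ≤ T, t ≥ −z}. If u₁⁺ = u₂⁺ on Σ_l and u₁⁻ = u₂⁻ on Σ_r, then q₁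 = q₂ on ℝⁿ. -/

import Mathlib

open MeasureTheory

/-- Second directional derivative of `f` at `p` in direction `v`. -/
noncomputable def dir2 {E : Type*} [NormedAddCommGroup E] [NormedSpace ℝ E]
    (f : E → ℝ) (p v : E) : ℝ :=
  iteratedDeriv 2 (fun s : ℝ => f (p + s • v)) 0

/-- The wave operator `□u = ∂ₜ²u − Δₓu` acting on functions of
`((y,z),t) ∈ (ℝ^m × ℝ) × ℝ` (so the space variable is `x = (y,z) ∈ ℝⁿ`, `n = m+1`). -/
noncomputable def waveOp (m : ℕ) (u : (EuclideanSpace ℝ (Fin m) × ℝ) × ℝ → ℝ)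
    (p : (EuclideanSpace ℝ (Fin m) × ℝ) × ℝ) : ℝ :=
  dir2 u p (0, 1)
    - ((∑ i : Fin m, dir2 u p ((EuclideanSpace.single i 1, 0), 0))
        + dir2 u p (((0 : EuclideanSpace ℝ (Fin m)), (1 : ℝ)), 0))

open Set Filter Topology
open scoped ContDiff

theorem countable_simple_zeros {g g' : ℝ → ℝ} {U : Set ℝ}
    (hg : ∀ r ∈ U, HasDerivAt g (g' r) r) :
    {r ∈ U | g r = 0 ∧ g' r ≠ 0}.Countable := by
  refine (countable_setOfPred_isolated_right_within (s := {r | g r = 0})).mono ?_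
  rintro r ⟨hrU, hr0, hr1⟩
  refine ⟨hr0, ?_⟩
  have h1 : ∀ᶠ z in 𝓝[>] r, g z ≠ 0 :=
    ((hg r hrU).eventually_ne hr1).filter_mono (nhdsWithin_mono _ (fun z hz => ne_of_gt hz))
  rw [← eventually_false_iff_eq_bot]
  filter_upwards [h1.filter_mono (nhdsWithin_mono _ inter_subset_right), self_mem_nhdsWithin]
    with z hz hz' using hz hz'.1

/-- The fundamental theorem of calculus for a function cut off to an open set at whose boundary
points it vanishes. -/
theorem integral_indicator_deriv {g g' : ℝ → ℝ} {A : Set ℝ} {a b : ℝ} (hab : a ≤ b)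
    (hA : IsOpen A) (hc : ContinuousOn g (Icc a b))
    (hd : ∀ r ∈ Ioo a b, HasDerivAt g (g' r) r) (hi : IntervalIntegrable g' volume a b)
    (hfr : ∀ r ∈ Icc a b, r ∈ frontier A → g r = 0) :
    ∫ r in a..b, A.indicator g' r = A.indicator g b - A.indicator g a := by
  have hle : ∀ r, |A.indicator g r| ≤ |g r| := fun r => by
    by_cases hr : r ∈ A
    · simp [hr]
    · simp [hr]
  refine integral_eq_of_hasDerivAt_off_countable _ _ (countable_simple_zeros hd) ?_ ?_ ?_
  · rw [uIcc_of_le hab]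
    intro r hr
    by_cases hrf : r ∈ frontier A
    · have h0 := hfr r hr hrf
      have h1 : A.indicator g r = 0 := by
        have := hle r; rw [h0] at this; simpa using this
      have h2 := (hc r hr)
      rw [ContinuousWithinAt, h0] at h2
      rw [ContinuousWithinAt, h1]
      exact squeeze_zero_norm (a := fun r => |g r|) (fun r => hle r) (by simpa using h2.abs)
    · rw [hA.frontier_eq, Set.mem_sdiff, not_and_not_right] at hrf
      by_cases hrA : r ∈ A
      · refine (hc r hr).congr_of_eventuallyEq ?_ (by simp [hrA])
        filter_upwards [mem_nhdsWithin_of_mem_nhds (hA.mem_nhds hrA)] with z hz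
        simp [hz]
      · have : r ∉ closure A := fun h => hrA (hrf h)
        refine (continuousWithinAt_const (b := (0 : ℝ))).congr_of_eventuallyEq ?_ (by simp [hrA])
        filter_upwards [mem_nhdsWithin_of_mem_nhds
          (isClosed_closure.isOpen_compl.mem_nhds this)] with z hz
        simp [show z ∉ A from fun h => hz (subset_closure h)]
  · rw [min_eq_left hab, max_eq_right hab]
    rintro r ⟨hr, hrn⟩
    by_cases hrf : r ∈ frontier A
    · have h0 := hfr r (Ioo_subset_Icc_self hr) hrf
      have h1 : A.indicator g r = 0 := by
        have := hle r; rw [h0] at this; simpa using this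
      have h2 : g' r = 0 := by
        by_contra h; exact hrn ⟨hr, h0, h⟩
      have h3 : A.indicator g' r = 0 := by
        simp [h2]
      rw [h3]
      have h4 := hd r hr
      rw [h2, hasDerivAt_iff_isLittleO] at h4
      rw [hasDerivAt_iff_isLittleO]
      refine (Asymptotics.IsBigO.of_bound 1 (Eventually.of_forall fun z => ?_)).trans_isLittleO h4
      simpa [h0, h1] using hle z
    · rw [hA.frontier_eq, Set.mem_sdiff, not_and_not_right] at hrf
      by_cases hrA : r ∈ A
      · rw [indicator_of_mem hrA]
        refine (hd r hr).congr_of_eventuallyEq ?_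
        filter_upwards [hA.mem_nhds hrA] with z hz
        simp [hz]
      · have : r ∉ closure A := fun h => hrA (hrf h)
        rw [indicator_of_notMem hrA]
        refine (hasDerivAt_const r (0 : ℝ)).congr_of_eventuallyEq ?_
        filter_upwards [isClosed_closure.isOpen_compl.mem_nhds this] with z hz
        simp [show z ∉ A from fun h => hz (subset_closure h)]
  · rw [intervalIntegrable_iff] at hi ⊢
    exact hi.indicator hA.measurableSet

/-- The space variables `x = (y, z)`. -/
abbrev Space (m : ℕ) : Type := EuclideanSpace ℝ (Fin m) × ℝ

/-- Points `(x, s)`, where `s ≥ 0` measures the time elapsed since the wave front passed `x`. -/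
abbrev SpaceTime (m : ℕ) : Type := Space m × ℝ

/-- The closed half space `s ≥ 0`. -/
def halfSpace (m : ℕ) : Set (SpaceTime m) := {p | 0 ≤ p.2}

theorem interior_halfSpace_eq (m : ℕ) : interior (halfSpace m) = {p | 0 < p.2} := by
  have h : halfSpace m = univ ×ˢ Ici (0 : ℝ) := by
    ext p; simp [halfSpace]
  rw [h, interior_prod_eq, interior_Ici, interior_univ]
  ext p; simp

theorem convex_halfSpace (m : ℕ) : Convex ℝ (halfSpace m) := by
  intro p hp q hq a b ha hb _
  simp only [halfSpace, mem_ofPred_eq, Prod.snd_add, Prod.smul_snd, smul_eq_mul] at *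
  positivity

theorem uniqueDiffOn_halfSpace (m : ℕ) : UniqueDiffOn ℝ (halfSpace m) := by
  refine uniqueDiffOn_convex (convex_halfSpace m) ?_
  rw [interior_halfSpace_eq]
  exact ⟨(0, 1), by simp⟩

theorem isClosed_halfSpace (m : ℕ) : IsClosed (halfSpace m) :=
  isClosed_le continuous_const continuous_snd

/-- The functions that are smooth up to the boundary on the half space. -/
def smoothAlg (m : ℕ) : Subalgebra ℝ (SpaceTime m → ℝ) where
  carrier := {f | ContDiffOn ℝ ∞ f (halfSpace m)}
  mul_mem' hf hg := ContDiffOn.mul hf hg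
  add_mem' hf hg := ContDiffOn.add hf hg
  algebraMap_mem' _ := contDiffOn_const

variable {m : ℕ}

theorem contDiffOn_coe (f : smoothAlg m) : ContDiffOn ℝ ∞ f.1 (halfSpace m) := f.2

theorem hasFDerivWithinAt_coe (f : smoothAlg m) {p : SpaceTime m} (hp : p ∈ halfSpace m) :
    HasFDerivWithinAt f.1 (fderivWithin ℝ f.1 (halfSpace m) p) (halfSpace m) p :=
  (((contDiffOn_coe f).differentiableOn (by simp)) p hp).hasFDerivWithinAt

/-- The derivative in the constant direction `e`, as a derivation. -/
noncomputable def dirD (e : SpaceTime m) : Derivation ℝ (smoothAlg m) (smoothAlg m) :=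
  Derivation.mk'
    { toFun := fun f => ⟨(halfSpace m).indicator
          (fun p => fderivWithin ℝ f.1 (halfSpace m) p e),
        (((contDiffOn_coe f).fderivWithin (uniqueDiffOn_halfSpace m)
          (le_of_eq (by rfl))).clm_apply contDiffOn_const).congr
            (fun p hp => indicator_of_mem hp _)⟩
      map_add' := fun f g => by
        ext p
        by_cases hp : p ∈ halfSpace m
        · simp only [hp, indicator_of_mem, Subalgebra.coe_add, Pi.add_apply]
          rw [((hasFDerivWithinAt_coe f hp).add (hasFDerivWithinAt_coe g hp)).fderivWithin
            (uniqueDiffOn_halfSpace m p hp)]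
          rfl
        · simp [hp]
      map_smul' := fun r f => by
        ext p
        by_cases hp : p ∈ halfSpace m
        · simp only [hp, indicator_of_mem, Subalgebra.coe_smul, Pi.smul_apply, RingHom.id_apply]
          rw [((hasFDerivWithinAt_coe f hp).const_smul r).fderivWithin
            (uniqueDiffOn_halfSpace m p hp)]
          rfl
        · simp [hp] }
    (fun f g => by
      ext p
      by_cases hp : p ∈ halfSpace m
      · simp only [LinearMap.coe_mk, AddHom.coe_mk, hp, indicator_of_mem, Subalgebra.coe_mul,
          Subalgebra.coe_add, Pi.add_apply, Pi.mul_apply, smul_eq_mul]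
        rw [((hasFDerivWithinAt_coe f hp).mul (hasFDerivWithinAt_coe g hp)).fderivWithin
          (uniqueDiffOn_halfSpace m p hp)]
        simp
      · simp [hp])

theorem dirD_apply (e : SpaceTime m) (f : smoothAlg m) {p : SpaceTime m} (hp : p ∈ halfSpace m) :
    (dirD e f).1 p = fderivWithin ℝ f.1 (halfSpace m) p e :=
  indicator_of_mem hp (fun p => fderivWithin ℝ f.1 (halfSpace m) p e)

theorem dirD_apply_of_notMem (e : SpaceTime m) (f : smoothAlg m) {p : SpaceTime m}
    (hp : p ∉ halfSpace m) : (dirD e f).1 p = 0 :=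
  indicator_of_notMem hp (fun p => fderivWithin ℝ f.1 (halfSpace m) p e)

theorem dirD_comm (e e' : SpaceTime m) (f : smoothAlg m) :
    dirD e (dirD e' f) = dirD e' (dirD e f) := by
  have key : ∀ (a b : SpaceTime m) {p : SpaceTime m} (_ : p ∈ halfSpace m),
      (dirD a (dirD b f)).1 p
        = fderivWithin ℝ (fderivWithin ℝ f.1 (halfSpace m)) (halfSpace m) p a b := by
    intro a b p hp
    have h1 : DifferentiableWithinAt ℝ (fderivWithin ℝ f.1 (halfSpace m)) (halfSpace m) p :=
      (((contDiffOn_coe f).fderivWithin (m := ∞) (uniqueDiffOn_halfSpace m)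
          (le_of_eq (by rfl))).differentiableOn (by simp)) p hp
    have h2 : HasFDerivWithinAt (dirD b f).1
        ((ContinuousLinearMap.apply ℝ ℝ b).comp
          (fderivWithin ℝ (fderivWithin ℝ f.1 (halfSpace m)) (halfSpace m) p)) (halfSpace m) p :=
      ((ContinuousLinearMap.apply ℝ ℝ b).hasFDerivAt.comp_hasFDerivWithinAt p
        h1.hasFDerivWithinAt).congr (fun x hx => dirD_apply b f hx) (dirD_apply b f hp)
    rw [dirD_apply _ _ hp, h2.fderivWithin (uniqueDiffOn_halfSpace m p hp)]
    rfl
  ext p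
  by_cases hp : p ∈ halfSpace m
  · rw [key _ _ hp, key _ _ hp]
    refine (ContDiffWithinAt.isSymmSndFDerivWithinAt ((contDiffOn_coe f) p hp) ?_
      (uniqueDiffOn_halfSpace m) ?_ hp).eq e e'
    · rw [minSmoothness_of_isRCLikeNormedField]
      exact ENat.LEInfty.out
    · rw [(convex_halfSpace m).closure_interior_eq_closure_of_nonempty_interior]
      · exact subset_closure hp
      · rw [interior_halfSpace_eq]
        exact ⟨(0, 1), by simp⟩
  · rw [dirD_apply_of_notMem _ _ hp, dirD_apply_of_notMem _ _ hp]

theorem dirD_add_dir (e e' : SpaceTime m) (f : smoothAlg m) :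
    dirD (e + e') f = dirD e f + dirD e' f := by
  ext p
  by_cases hp : p ∈ halfSpace m
  · simp [dirD_apply _ _ hp]
  · simp [dirD_apply_of_notMem _ _ hp]

theorem dirD_smul_dir (r : ℝ) (e : SpaceTime m) (f : smoothAlg m) :
    dirD (r • e) f = r • dirD e f := by
  ext p
  by_cases hp : p ∈ halfSpace m
  · simp [dirD_apply _ _ hp]
  · simp [dirD_apply_of_notMem _ _ hp]

/-- Local determination of derivatives. -/
theorem dirD_congr (e : SpaceTime m) {f g : smoothAlg m} {U : Set (SpaceTime m)} (hU : IsOpen U)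
    (h : ∀ p ∈ U, p ∈ halfSpace m → f.1 p = g.1 p) :
    ∀ p ∈ U, p ∈ halfSpace m → (dirD e f).1 p = (dirD e g).1 p := by
  intro p hpU hp
  rw [dirD_apply _ _ hp, dirD_apply _ _ hp]
  have : f.1 =ᶠ[𝓝[halfSpace m] p] g.1 := by
    filter_upwards [mem_nhdsWithin_of_mem_nhds (hU.mem_nhds hpU), self_mem_nhdsWithin] with x hx hx'
    exact h x hx hx'
  rw [this.fderivWithin_eq (h p hpU hp)]

theorem hasDerivWithinAt_line (f : smoothAlg m) (p e : SpaceTime m) {r : ℝ} {I : Set ℝ}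
    (hI : MapsTo (fun r : ℝ => p + r • e) I (halfSpace m)) (hr : p + r • e ∈ halfSpace m) :
    HasDerivWithinAt (fun r : ℝ => f.1 (p + r • e)) ((dirD e f).1 (p + r • e)) I r := by
  rw [dirD_apply _ _ hr]
  have h1 : HasDerivWithinAt (fun r : ℝ => p + r • e) e I r := by
    have := ((hasDerivWithinAt_id r I).smul_const e).const_add p
    simpa using this
  exact (hasFDerivWithinAt_coe f hr).comp_hasDerivWithinAt r h1 hI

theorem continuousOn_coe (f : smoothAlg m) : ContinuousOn f.1 (halfSpace m) :=
  (contDiffOn_coe f).continuousOn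

/-- Lebesgue measure on the half space. -/
noncomputable def halfMeasure (m : ℕ) : Measure (SpaceTime m) :=
  (volume : Measure (Space m)).prod ((volume : Measure ℝ).restrict (Ioi 0))

instance (m : ℕ) : SFinite (halfMeasure m) := by unfold halfMeasure; infer_instance

theorem halfMeasure_eq (m : ℕ) :
    halfMeasure m = (volume : Measure (SpaceTime m)).restrict {p | 0 < p.2} := by
  have : ({p | 0 < p.2} : Set (SpaceTime m)) = univ ×ˢ Ioi 0 := by ext p; simp
  rw [halfMeasure, this, Measure.volume_eq_prod (Space m) ℝ, ← Measure.prod_restrict,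
    Measure.restrict_univ]

theorem ae_halfMeasure : ∀ᵐ p ∂(halfMeasure m), 0 < p.2 := by
  rw [halfMeasure_eq]
  exact ae_restrict_mem (measurableSet_lt measurable_const measurable_snd)

/-- `f` vanishes on the points of `Ω` in the half space of norm larger than `R`. -/
def BddOn (Ω : Set (SpaceTime m)) (R : ℝ) (f : smoothAlg m) : Prop :=
  ∀ p ∈ halfSpace m, p ∈ Ω → R < ‖p‖ → f.1 p = 0

theorem BddOn.dirD {Ω : Set (SpaceTime m)} {R : ℝ} {f : smoothAlg m} (hΩ : IsOpen Ω)
    (h : BddOn Ω R f) (e : SpaceTime m) : BddOn Ω R (dirD e f) := by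
  intro p hp hpΩ hpR
  have := dirD_congr e (f := f) (g := 0) (U := Ω ∩ {p | R < ‖p‖})
    (hΩ.inter (isOpen_lt continuous_const continuous_norm))
    (fun p hp hp' => by simpa using h p hp' hp.1 hp.2) p ⟨hpΩ, hpR⟩ hp
  simpa using this

theorem integrable_indicator_of_bddOn {Ω : Set (SpaceTime m)} {R : ℝ} {f : smoothAlg m}
    (hΩ : IsOpen Ω) (h : BddOn Ω R f) : Integrable (Ω.indicator f.1) (halfMeasure m) := by
  have hK : IsCompact (halfSpace m ∩ Metric.closedBall 0 R) :=
    (isCompact_closedBall 0 R).inter_left (isClosed_halfSpace m)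
  have h1 : IntegrableOn f.1 (halfSpace m ∩ Metric.closedBall 0 R) volume :=
    ((continuousOn_coe f).mono inter_subset_left).integrableOn_compact hK
  have h2 : Integrable ((halfSpace m ∩ Metric.closedBall 0 R).indicator (Ω.indicator f.1))
      (halfMeasure m) := by
    rw [halfMeasure_eq]
    refine Integrable.mono_measure ?_ Measure.restrict_le_self
    rw [integrable_indicator_iff hK.measurableSet]
    exact h1.indicator hΩ.measurableSet
  refine h2.congr ?_
  filter_upwards [ae_halfMeasure] with p hp
  have hp' : p ∈ halfSpace m := le_of_lt hp
  by_cases hpR : ‖p‖ ≤ R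
  · rw [indicator_of_mem]
    exact ⟨hp', by simpa using hpR⟩
  · rw [indicator_of_notMem]
    · by_cases hpΩ : p ∈ Ω
      · rw [indicator_of_mem hpΩ, h p hp' hpΩ (not_le.1 hpR)]
      · rw [indicator_of_notMem hpΩ]
    · rintro ⟨_, h3⟩
      exact hpR (by simpa using h3)

theorem measurePreserving_translate (v : Space m) :
    MeasurePreserving (fun p : SpaceTime m => p + (v, (0 : ℝ))) (halfMeasure m) (halfMeasure m) := by
  have hinv : (volume : Measure (Space m)).IsAddRightInvariant := by
    rw [Measure.volume_eq_prod]; infer_instance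
  have h := (measurePreserving_add_right (volume : Measure (Space m)) v).prod
    (MeasurePreserving.id ((volume : Measure ℝ).restrict (Ioi 0)))
  have hfun : (fun p : SpaceTime m => p + (v, (0 : ℝ))) = Prod.map (fun x => x + v) id := by
    ext p <;> simp
  rw [hfun]
  exact h

theorem integral_dirD_tangential {Ω : Set (SpaceTime m)} {R : ℝ} {f : smoothAlg m}
    (hΩ : IsOpen Ω) (h : BddOn Ω R f) (v : Space m)
    (hfr : ∀ p ∈ halfSpace m, (0 : ℝ) ∈ frontier {r : ℝ | p + r • (v, (0 : ℝ)) ∈ Ω} → f.1 p = 0) :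
    ∫ p, Ω.indicator (dirD (v, 0) f).1 p ∂(halfMeasure m) = 0 := by
  set e : SpaceTime m := (v, 0) with he
  set F := Ω.indicator f.1 with hF
  set G := Ω.indicator (dirD e f).1 with hG
  have hFi : Integrable F (halfMeasure m) := integrable_indicator_of_bddOn hΩ h
  have hGi : Integrable G (halfMeasure m) := integrable_indicator_of_bddOn hΩ (h.dirD hΩ e)
  have hT : ∀ u : ℝ, MeasurePreserving (fun p : SpaceTime m => p + u • e)
      (halfMeasure m) (halfMeasure m) := by
    intro u
    have := measurePreserving_translate (u • v)
    simpa [he] using this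
  have hTe : ∀ u : ℝ, MeasurableEmbedding (fun p : SpaceTime m => p + u • e) := fun u =>
    measurableEmbedding_addRight (u • e)
  have hline : ∀ p : SpaceTime m, 0 < p.2 →
      F (p + (1 : ℝ) • e) - F p = ∫ u in Ioc (0 : ℝ) 1, G (p + u • e) := by
    intro p hp
    have hmem : ∀ u : ℝ, p + u • e ∈ halfSpace m := fun u => by
      simp [halfSpace, he, hp.le]
    have hcont : ∀ g : smoothAlg m, Continuous fun u : ℝ => g.1 (p + u • e) := fun g =>
      (continuousOn_coe g).comp_continuous (by fun_prop) hmem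
    have hopen : IsOpen {r : ℝ | p + r • e ∈ Ω} :=
      hΩ.preimage (by fun_prop : Continuous fun r : ℝ => p + r • e)
    have := integral_indicator_deriv (g := fun u => f.1 (p + u • e))
      (g' := fun u => (dirD e f).1 (p + u • e)) (A := {r : ℝ | p + r • e ∈ Ω})
      zero_le_one hopen (hcont f).continuousOn (fun r _ => by
        have := hasDerivWithinAt_line f p e (r := r) (I := univ) (fun u _ => hmem u) (hmem r)
        simpa using this) ((hcont _).intervalIntegrable _ _) (fun r _ hr => by
        refine hfr _ (hmem r) ?_
        have : {r' : ℝ | p + r • e + r' • e ∈ Ω} = (fun r' => r + r') ⁻¹' {r : ℝ | p + r • e ∈ Ω} := by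
          ext r'; simp [add_smul, add_assoc]
        rw [this, ← Homeomorph.coe_addLeft, ← Homeomorph.preimage_frontier]
        simpa using hr)
    rw [intervalIntegral.integral_of_le zero_le_one] at this
    have e1 : ∀ r : ℝ, ∀ g : smoothAlg m, {r : ℝ | p + r • e ∈ Ω}.indicator
        (fun u => g.1 (p + u • e)) r = Ω.indicator g.1 (p + r • e) := fun r g => rfl
    simp only [e1] at this
    rw [hF, hG, this]
    simp
  have hjoint : Integrable (fun q : ℝ × SpaceTime m => G (q.2 + q.1 • e))
      (((volume : Measure ℝ).restrict (Ioc 0 1)).prod (halfMeasure m)) := by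
    have hmp : MeasurePreserving (fun q : ℝ × SpaceTime m => (q.1, q.2 + q.1 • e))
        (((volume : Measure ℝ).restrict (Ioc 0 1)).prod (halfMeasure m))
        (((volume : Measure ℝ).restrict (Ioc 0 1)).prod (halfMeasure m)) :=
      (MeasurePreserving.id _).skew_product (g := fun u p => p + u • e)
        (by simp only [Function.uncurry_def]; fun_prop)
        (Eventually.of_forall fun u => (hT u).map_eq)
    exact hmp.integrable_comp_of_integrable (hGi.comp_snd _)
  have h1 : ∫ p, (F (p + (1 : ℝ) • e) - F p) ∂(halfMeasure m) = 0 := by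
    have h0 : Integrable (fun p => F (p + (1 : ℝ) • e)) (halfMeasure m) :=
      (hT 1).integrable_comp_of_integrable hFi
    rw [integral_sub h0 hFi, (hT 1).integral_comp (hTe 1) F, sub_self]
  have h2 : ∫ p, (F (p + (1 : ℝ) • e) - F p) ∂(halfMeasure m)
      = ∫ p, (∫ u in Ioc (0 : ℝ) 1, G (p + u • e)) ∂(halfMeasure m) := by
    refine integral_congr_ae ?_
    filter_upwards [ae_halfMeasure] with p hp using hline p hp
  rw [h1, ← integral_integral_swap (f := fun u p => G (p + u • e)) hjoint] at h2
  have h3 : ∀ u : ℝ, ∫ p, G (p + u • e) ∂(halfMeasure m) = ∫ p, G p ∂(halfMeasure m) := fun u =>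
    (hT u).integral_comp (hTe u) G
  simp only [h3] at h2
  simpa using h2.symm

theorem integral_dirD_normal {Ω : Set (SpaceTime m)} {R : ℝ} {f : smoothAlg m}
    (hΩ : IsOpen Ω) (h : BddOn Ω R f)
    (hfr : ∀ p ∈ halfSpace m,
      (0 : ℝ) ∈ frontier {r : ℝ | p + r • ((0 : Space m), (1 : ℝ)) ∈ Ω} → f.1 p = 0) :
    ∫ p, Ω.indicator (dirD (0, 1) f).1 p ∂(halfMeasure m)
      = - ∫ x : Space m, Ω.indicator f.1 (x, 0) := by
  set e : SpaceTime m := (0, 1) with he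
  have hGi : Integrable (Ω.indicator (dirD e f).1) (halfMeasure m) :=
    integrable_indicator_of_bddOn hΩ (h.dirD hΩ e)
  rw [halfMeasure, integral_prod _ hGi, ← integral_neg]
  congr 1
  ext x
  set b := |R| + 1 with hb
  have hb0 : 0 ≤ b := by positivity
  have hmem : ∀ u : ℝ, 0 ≤ u → ((x, 0) : SpaceTime m) + u • e ∈ halfSpace m := fun u hu => by
    simp [halfSpace, he, hu]
  have hpt : ∀ u : ℝ, ((x, 0) : SpaceTime m) + u • e = (x, u) := fun u => by simp [he]
  have hopen : IsOpen {r : ℝ | ((x, 0) : SpaceTime m) + r • e ∈ Ω} :=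
    hΩ.preimage (by fun_prop : Continuous fun r : ℝ => ((x, 0) : SpaceTime m) + r • e)
  have hcont : ∀ g : smoothAlg m, ContinuousOn (fun u : ℝ => g.1 ((x, 0) + u • e)) (Icc 0 b) :=
    fun g => (continuousOn_coe g).comp (by fun_prop) (fun u hu => hmem u hu.1)
  have hzero : ∀ g : smoothAlg m, BddOn Ω R g → ∀ u, b ≤ u → Ω.indicator g.1 (x, u) = 0 := by
    intro g hg u hu
    by_cases hx : ((x, u) : SpaceTime m) ∈ Ω
    · rw [indicator_of_mem hx]
      refine hg _ ?_ hx ?_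
      · exact hb0.trans hu
      · have h1 : ‖u‖ ≤ ‖((x, u) : SpaceTime m)‖ := norm_snd_le (x, u)
        have h2 : u ≤ ‖u‖ := le_abs_self u
        have h3 : R ≤ |R| := le_abs_self R
        linarith
    · rw [indicator_of_notMem hx]
  have key := integral_indicator_deriv (g := fun u => f.1 ((x, 0) + u • e))
      (g' := fun u => (dirD e f).1 ((x, 0) + u • e))
      (A := {r : ℝ | ((x, 0) : SpaceTime m) + r • e ∈ Ω})
      hb0 hopen (hcont f) (fun r hr => by
        have := hasDerivWithinAt_line f (x, 0) e (r := r) (I := Ici 0) (fun u hu => hmem u hu)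
          (hmem r hr.1.le)
        exact this.hasDerivAt (Ici_mem_nhds hr.1)) (ContinuousOn.intervalIntegrable (by
          rw [uIcc_of_le hb0]; exact hcont _)) (fun r hr0 hr => by
        refine hfr _ (hmem r hr0.1) ?_
        have : {r' : ℝ | (x, 0) + r • e + r' • e ∈ Ω}
            = (fun r' => r + r') ⁻¹' {r : ℝ | (x, 0) + r • e ∈ Ω} := by
          ext r'; simp [add_smul, add_assoc]
        rw [this, ← Homeomorph.coe_addLeft, ← Homeomorph.preimage_frontier]
        simpa using hr)
  have e1 : ∀ r : ℝ, ∀ g : smoothAlg m, {r : ℝ | ((x, 0) : SpaceTime m) + r • e ∈ Ω}.indicator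
        (fun u => g.1 ((x, 0) + u • e)) r = Ω.indicator g.1 (x, r) := fun r g => by
    rw [← hpt r]; rfl
  simp only [e1] at key
  rw [hzero f h b le_rfl, zero_sub, intervalIntegral.integral_of_le hb0] at key
  rw [← key]
  refine setIntegral_eq_of_subset_of_forall_sdiff_eq_zero measurableSet_Ioi
    Ioc_subset_Ioi_self ?_
  intro u hu
  refine hzero _ (h.dirD hΩ e) u ?_
  by_contra hlt
  exact hu.2 ⟨hu.1, (not_le.1 hlt).le⟩

theorem integral_dirD {Ω : Set (SpaceTime m)} {R : ℝ} {f : smoothAlg m}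
    (hΩ : IsOpen Ω) (h : BddOn Ω R f) (hfr : ∀ p ∈ halfSpace m, p ∈ frontier Ω → f.1 p = 0)
    (e : SpaceTime m) :
    ∫ p, Ω.indicator (dirD e f).1 p ∂(halfMeasure m)
      = - (e.2 * ∫ x : Space m, Ω.indicator f.1 (x, 0)) := by
  have hline : ∀ (p e : SpaceTime m), (0 : ℝ) ∈ frontier {r : ℝ | p + r • e ∈ Ω} →
      p ∈ frontier Ω := by
    intro p e hp
    have hc : Continuous fun r : ℝ => p + r • e := by fun_prop
    simpa using hc.frontier_preimage_subset Ω hp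
  have he : e = (e.1, 0) + e.2 • ((0 : Space m), (1 : ℝ)) := by ext <;> simp
  have h1 := integral_dirD_tangential hΩ h e.1 (fun p hp hp' => hfr p hp (hline p _ hp'))
  have h2 := integral_dirD_normal hΩ h (fun p hp hp' => hfr p hp (hline p _ hp'))
  have h3 : Ω.indicator (dirD e f).1 = fun p => Ω.indicator (dirD (e.1, 0) f).1 p
      + e.2 * Ω.indicator (dirD (0, 1) f).1 p := by
    ext p
    conv_lhs => rw [he, dirD_add_dir, dirD_smul_dir]
    by_cases hp : p ∈ Ω <;> simp [hp]
  rw [h3, integral_add (integrable_indicator_of_bddOn hΩ (h.dirD hΩ _))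
    ((integrable_indicator_of_bddOn hΩ (h.dirD hΩ _)).const_mul _), h1, integral_const_mul, h2]
  ring

section Algebra

variable {κ A : Type*} [Fintype κ] [CommRing A] [Algebra ℝ A]

/-- The second order operator `∑ cₖ Dₖ²`. -/
def quadOp (D : κ → Derivation ℝ A A) (c : κ → ℝ) (f : A) : A :=
  ∑ k, algebraMap ℝ A (c k) * D k (D k f)

/-- The bilinear form `∑ cₖ Dₖf Dₖg`. -/
def gradForm (D : κ → Derivation ℝ A A) (c : κ → ℝ) (f g : A) : A :=
  ∑ k, algebraMap ℝ A (c k) * (D k f * D k g)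

/-- The Hessian of `φ` contracted with the gradient of `f`. -/
def hessForm (D : κ → Derivation ℝ A A) (c : κ → ℝ) (φ f : A) : A :=
  ∑ k, ∑ l, algebraMap ℝ A (c k) * algebraMap ℝ A (c l) * (D k (D l φ) * (D k f * D l f))

/-- The flux in the Carleman divergence identity. -/
def carlemanFlux (D : κ → Derivation ℝ A A) (c : κ → ℝ) (τ φ θ w : A) (k : κ) : A :=
  algebraMap ℝ A (c k) * (-(4 * τ * (D k w * gradForm D c φ w)) + 2 * τ * (D k φ * gradForm D c w w)
    - 2 * τ ^ 3 * (gradForm D c φ φ * D k φ * w ^ 2) - 2 * τ * (θ * w * D k w)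
    + τ * (D k θ * w ^ 2))

theorem carleman_identity (D : κ → Derivation ℝ A A) (hD : ∀ k l f, D k (D l f) = D l (D k f))
    (c : κ → ℝ) (r : ℝ) (τ φ θ w : A) (hτ : τ = algebraMap ℝ A r) :
    ∑ k, D k (carlemanFlux D c τ φ θ w k)
      = 2 * (quadOp D c w + τ ^ 2 * gradForm D c φ φ * w)
          * (-(2 * τ * gradForm D c φ w) - τ * θ * w)
        - (4 * τ * hessForm D c φ w + 2 * τ * (θ - quadOp D c φ) * gradForm D c w w
          + τ ^ 3 * (4 * hessForm D c φ φ + 2 * gradForm D c φ φ * (quadOp D c φ - θ)) * w ^ 2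
          - τ * quadOp D c θ * w ^ 2) := by
  set C : κ → A := fun k => algebraMap ℝ A (c k) with hC
  have dC : ∀ k l, D k (C l) = 0 := fun k l => Derivation.map_algebraMap _ _
  have dτ : ∀ k, D k τ = 0 := fun k => by rw [hτ]; exact Derivation.map_algebraMap _ _
  have dgrad : ∀ (k : κ) (f g : A), D k (gradForm D c f g)
      = ∑ l, C l * (D k (D l f) * D l g) + ∑ l, C l * (D l f * D k (D l g)) := by
    intro k f g
    simp only [gradForm, map_sum, Derivation.leibniz, smul_eq_mul]
    rw [← Finset.sum_add_distrib]
    refine Finset.sum_congr rfl fun l _ => ?_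
    have := dC k l
    simp only [hC] at this
    rw [this]
    simp only [hC]
    ring
  have hM : ∑ k, C k * D k w * D k (gradForm D c φ w)
      = hessForm D c φ w
        + ∑ k, ∑ l, C k * C l * (D k w * D l φ * D k (D l w)) := by
    rw [hessForm, ← Finset.sum_add_distrib]
    refine Finset.sum_congr rfl fun k _ => ?_
    rw [dgrad, mul_add, Finset.mul_sum, Finset.mul_sum]
    congr 1 <;> exact Finset.sum_congr rfl fun l _ => by ring
  have hN : ∑ k, C k * D k φ * D k (gradForm D c w w)
      = 2 * ∑ k, ∑ l, C k * C l * (D k w * D l φ * D k (D l w)) := by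
    rw [Finset.sum_comm, Finset.mul_sum]
    refine Finset.sum_congr rfl fun k _ => ?_
    rw [dgrad, mul_add, Finset.mul_sum, Finset.mul_sum, Finset.mul_sum, ← Finset.sum_add_distrib]
    refine Finset.sum_congr rfl fun l _ => ?_
    rw [hD l k]
    ring
  have hG : ∑ k, C k * D k φ * D k (gradForm D c φ φ) = 2 * hessForm D c φ φ := by
    rw [hessForm, Finset.mul_sum]
    refine Finset.sum_congr rfl fun k _ => ?_
    rw [dgrad, mul_add, Finset.mul_sum, Finset.mul_sum, Finset.mul_sum, ← Finset.sum_add_distrib]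
    refine Finset.sum_congr rfl fun l _ => ?_
    ring
  have hk : ∀ k, D k (carlemanFlux D c τ φ θ w k)
      = C k * D k (D k w) * (-(4 * τ * gradForm D c φ w) - 2 * τ * θ * w)
        + C k * D k w * D k (gradForm D c φ w) * (-(4 * τ))
        + C k * D k (D k φ) * (2 * τ * gradForm D c w w - 2 * τ ^ 3 * gradForm D c φ φ * w ^ 2)
        + C k * D k φ * D k (gradForm D c w w) * (2 * τ)
        + C k * D k φ * D k (gradForm D c φ φ) * (-(2 * τ ^ 3 * w ^ 2))
        + C k * (D k φ * D k w) * (-(4 * τ ^ 3 * gradForm D c φ φ * w))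
        + C k * (D k w * D k w) * (-(2 * τ * θ))
        + C k * D k (D k θ) * (τ * w ^ 2) := by
    intro k
    have h2 : D k (2 : A) = 0 := by exact_mod_cast (D k).map_natCast 2
    have h4 : D k (4 : A) = 0 := by exact_mod_cast (D k).map_natCast 4
    change D k (C k * _) = _
    simp only [map_add, map_sub, map_neg, Derivation.leibniz, Derivation.leibniz_pow, smul_eq_mul,
      dC, dτ, h2, h4, nsmul_eq_mul]
    push_cast
    ring
  simp only [hk, Finset.sum_add_distrib, ← Finset.sum_mul]
  rw [hM, hN, hG]
  have e1 : ∀ f, ∑ k, C k * D k (D k f) = quadOp D c f := fun f => rfl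
  have e2 : ∀ f g, ∑ k, C k * (D k f * D k g) = gradForm D c f g := fun f g => rfl
  rw [e1, e1, e1, e2, e2]
  ring

variable {ι : Type*} [Fintype ι]

/-- The signature of the wave operator: the index `none` is the time direction. -/
def waveSign : Option ι → ℝ
  | none => -1
  | some _ => 1

/-- The sum of the squares of the derivatives. -/
def gradSq (D : κ → Derivation ℝ A A) (f : A) : A := ∑ k, D k f ^ 2

/-- The flux in the energy identity. -/
def energyFlux (D : Option ι → Derivation ℝ A A) (θ u : A) : Option ι → A
  | none => -(θ * gradSq D u)
  | some i => 2 * θ * D none u * D (some i) u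

theorem energy_identity (D : Option ι → Derivation ℝ A A)
    (hD : ∀ k l f, D k (D l f) = D l (D k f)) (θ u : A) :
    ∑ k, D k (energyFlux D θ u k) = 2 * θ * D none u * quadOp D waveSign u
      + 2 * D none u * ∑ i, D (some i) θ * D (some i) u - D none θ * gradSq D u := by
  have h2 : ∀ k, D k (2 : A) = 0 := fun k => by exact_mod_cast (D k).map_natCast 2
  simp only [Fintype.sum_option, energyFlux, gradSq, quadOp, waveSign, map_add, map_neg, map_one,
    Derivation.leibniz, Derivation.leibniz_pow, smul_eq_mul, map_sum, nsmul_eq_mul, h2]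
  have hi : ∀ i, 2 * θ * D none u * D (some i) (D (some i) u)
      + D (some i) u * (2 * θ * D (some i) (D none u)
        + D none u * (2 * D (some i) θ + θ * 0))
      = D (some i) (D (some i) u) * (2 * θ * D none u)
        + D (some i) u * D none (D (some i) u) * (2 * θ)
        + D (some i) θ * D (some i) u * (2 * D none u) := by
    intro i
    rw [hD (some i) none]
    ring
  simp only [hi, Finset.sum_add_distrib, ← Finset.sum_mul]
  have h3 : ∑ i, ((2 : ℕ) : A) * (D (some i) u ^ (2 - 1) * D none (D (some i) u))
      = 2 * ∑ i, D (some i) u * D none (D (some i) u) := by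
    rw [Finset.mul_sum]
    exact Finset.sum_congr rfl fun i _ => by push_cast; ring
  simp only [h3, one_mul]
  push_cast
  ring

/-- The conjugation of `∑ cₖ Dₖ²` by a solution `E` of `DₖE = τ E Dₖφ`. -/
theorem quadOp_conjugate (D : κ → Derivation ℝ A A) (c : κ → ℝ) (r : ℝ) (τ φ E V : A)
    (hτ : τ = algebraMap ℝ A r) (hE : ∀ k, D k E = τ * E * D k φ) :
    E * quadOp D c V = quadOp D c (E * V) + τ ^ 2 * gradForm D c φ φ * (E * V)
      - 2 * τ * gradForm D c φ (E * V) - τ * quadOp D c φ * (E * V) := by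
  have dτ : ∀ k, D k τ = 0 := fun k => by rw [hτ]; exact Derivation.map_algebraMap _ _
  simp only [quadOp, gradForm, Finset.mul_sum, Finset.sum_mul, ← Finset.sum_add_distrib,
    ← Finset.sum_sub_distrib]
  refine Finset.sum_congr rfl fun k _ => ?_
  simp only [Derivation.leibniz, smul_eq_mul, hE, dτ, map_add]
  ring

end Algebra

/-- Evaluation of a smooth function at a point. -/
def ev (p : SpaceTime m) : smoothAlg m →ₐ[ℝ] ℝ :=
  (Pi.evalAlgHom ℝ (fun _ : SpaceTime m => ℝ) p).comp (smoothAlg m).val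

theorem ev_apply (p : SpaceTime m) (f : smoothAlg m) : ev p f = f.1 p := rfl

theorem ev_algebraMap (p : SpaceTime m) (r : ℝ) : ev p (algebraMap ℝ (smoothAlg m) r) = r := rfl

theorem continuousOn_ev (f : smoothAlg m) : ContinuousOn (fun p => ev p f) (halfSpace m) :=
  continuousOn_coe f

theorem ev_dirD_congr (e : SpaceTime m) {f g : smoothAlg m} {U : Set (SpaceTime m)} (hU : IsOpen U)
    (h : ∀ p ∈ U, p ∈ halfSpace m → ev p f = ev p g) :
    ∀ p ∈ U, p ∈ halfSpace m → ev p (dirD e f) = ev p (dirD e g) :=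
  dirD_congr e hU h

theorem ev_dirD_congr_univ (e : SpaceTime m) {f g : smoothAlg m}
    (h : ∀ p ∈ halfSpace m, ev p f = ev p g) {p : SpaceTime m} (hp : p ∈ halfSpace m) :
    ev p (dirD e f) = ev p (dirD e g) :=
  ev_dirD_congr e isOpen_univ (fun p _ hp => h p hp) p (mem_univ p) hp

/-- Derivatives in tangential directions are determined by the restriction to `s = 0`. -/
theorem ev_dirD_slice (v : Space m) {f g : smoothAlg m}
    (h : ∀ x : Space m, ev (x, 0) f = ev (x, 0) g) (x : Space m) :
    ev (x, 0) (dirD (v, 0) f) = ev (x, 0) (dirD (v, 0) g) := by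
  have hmem : ∀ u : ℝ, ((x, 0) : SpaceTime m) + u • ((v, 0) : SpaceTime m) ∈ halfSpace m :=
    fun u => by simp [halfSpace]
  have key : ∀ f : smoothAlg m, HasDerivAt
      (fun r : ℝ => ev (x + r • v, 0) f) (ev (x, 0) (dirD (v, 0) f)) 0 := by
    intro f
    have := hasDerivWithinAt_line f (x, 0) (v, 0) (r := 0) (I := univ) (fun u _ => hmem u) (hmem 0)
    simpa [ev_apply] using this
  have h1 := key f
  simp only [h] at h1
  exact h1.unique (key g)

/-- A linear function as a smooth function. -/
def linElt (ℓ : SpaceTime m →L[ℝ] ℝ) : smoothAlg m := ⟨ℓ, ℓ.contDiff.contDiffOn⟩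

theorem ev_dirD_linElt (ℓ : SpaceTime m →L[ℝ] ℝ) (e : SpaceTime m) {p : SpaceTime m}
    (hp : p ∈ halfSpace m) : ev p (dirD e (linElt ℓ)) = ℓ e := by
  rw [ev_apply, dirD_apply _ _ hp]
  have : HasFDerivWithinAt (linElt ℓ).1 ℓ (halfSpace m) p := ℓ.hasFDerivWithinAt
  rw [this.fderivWithin (uniqueDiffOn_halfSpace m p hp)]

theorem ev_dirD_dirD_linElt (ℓ : SpaceTime m →L[ℝ] ℝ) (e e' : SpaceTime m) {p : SpaceTime m}
    (hp : p ∈ halfSpace m) : ev p (dirD e' (dirD e (linElt ℓ))) = 0 := by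
  rw [ev_dirD_congr_univ e' (g := algebraMap ℝ _ (ℓ e))
    (fun p hp => by rw [ev_dirD_linElt ℓ e hp, ev_algebraMap]) hp]
  simp

/-- The exponential of a smooth function. -/
noncomputable def expElt (f : smoothAlg m) : smoothAlg m :=
  ⟨fun p => Real.exp (f.1 p), (contDiffOn_coe f).exp⟩

theorem ev_expElt (f : smoothAlg m) (p : SpaceTime m) : ev p (expElt f) = Real.exp (ev p f) := rfl

theorem dirD_expElt (e : SpaceTime m) (f : smoothAlg m) :
    dirD e (expElt f) = expElt f * dirD e f := by
  ext p
  by_cases hp : p ∈ halfSpace m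
  · rw [dirD_apply _ _ hp, Subalgebra.coe_mul, Pi.mul_apply, dirD_apply _ _ hp]
    have : HasFDerivWithinAt (expElt f).1 _ (halfSpace m) p := (hasFDerivWithinAt_coe f hp).exp
    rw [this.fderivWithin (uniqueDiffOn_halfSpace m p hp)]
    rfl
  · rw [dirD_apply_of_notMem _ _ hp, Subalgebra.coe_mul, Pi.mul_apply,
      dirD_apply_of_notMem _ _ hp, mul_zero]

/-- The frame `∂_{y_i}`, `∂_z`, `∂_t` of the original coordinates, written in the coordinates
`(x, s)` with `s = t - σ z`. -/
noncomputable def frame (m : ℕ) (σ : ℝ) : Option (Option (Fin m)) → SpaceTime m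
  | none => (0, 1)
  | some none => ((0, 1), -σ)
  | some (some i) => ((EuclideanSpace.single i 1, 0), 0)

/-- The derivations along the frame. -/
noncomputable def frameD (m : ℕ) (σ : ℝ) (k : Option (Option (Fin m))) :
    Derivation ℝ (smoothAlg m) (smoothAlg m) :=
  dirD (frame m σ k)

theorem frameD_comm (σ : ℝ) (k l : Option (Option (Fin m))) (f : smoothAlg m) :
    frameD m σ k (frameD m σ l f) = frameD m σ l (frameD m σ k f) :=
  dirD_comm _ _ f

/-- The tangential derivative in the `z` direction. -/
theorem dirD_z_eq (σ : ℝ) (f : smoothAlg m) :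
    dirD ((0, 1), 0) f = frameD m σ (some none) f + σ • frameD m σ none f := by
  rw [frameD, frameD, ← dirD_smul_dir, ← dirD_add_dir]
  congr 2
  ext <;> simp [frame]

/-- The coordinate `y_i`. -/
noncomputable def coordY (i : Fin m) : smoothAlg m :=
  linElt ((EuclideanSpace.proj i).comp
    ((ContinuousLinearMap.fst ℝ _ _).comp (ContinuousLinearMap.fst ℝ _ _)))

/-- The coordinate `z`. -/
def coordZ : smoothAlg m :=
  linElt ((ContinuousLinearMap.snd ℝ _ _).comp (ContinuousLinearMap.fst ℝ _ _))

/-- The coordinate `s`. -/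
def coordS : smoothAlg m := linElt (ContinuousLinearMap.snd ℝ _ _)

@[simp] theorem ev_coordY (i : Fin m) (p : SpaceTime m) : ev p (coordY i) = p.1.1 i := rfl
@[simp] theorem ev_coordZ (p : SpaceTime m) : ev p coordZ = p.1.2 := rfl
@[simp] theorem ev_coordS (p : SpaceTime m) : ev p coordS = p.2 := rfl

/-- The square of the Euclidean norm of the space variable. -/
def normSq (x : Space m) : ℝ := ∑ i, x.1 i ^ 2 + x.2 ^ 2

theorem normSq_eq (x : Space m) : normSq x = ‖x.1‖ ^ 2 + x.2 ^ 2 := by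
  simp [normSq, EuclideanSpace.norm_sq_eq]

theorem continuous_normSq : Continuous (normSq (m := m)) := by
  unfold normSq; fun_prop

theorem integrable_slice_of_bddOn {f : smoothAlg m} {R : ℝ} (hf : BddOn univ R f) :
    Integrable (fun x : Space m => ev (x, 0) f) := by
  have hc : Continuous fun x : Space m => ev (x, 0) f :=
    (continuousOn_ev f).comp_continuous (by fun_prop) (fun x => by simp [halfSpace])
  refine hc.integrable_of_hasCompactSupport ?_
  refine HasCompactSupport.of_support_subset_isCompact (isCompact_closedBall (0 : Space m) R) ?_
  intro x hx
  by_contra hx'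
  refine hx (hf (x, 0) (by simp [halfSpace]) (mem_univ _) ?_)
  have h1 : ‖x‖ ≤ ‖((x, 0) : SpaceTime m)‖ := norm_fst_le (x, (0 : ℝ))
  have h2 : R < ‖x‖ := by simpa using hx'
  linarith

theorem integral_sum_frameD {J : Option (Option (Fin m)) → smoothAlg m} {R : ℝ} (σ : ℝ)
    (hJ : ∀ k, BddOn univ R (J k)) :
    ∫ p, ev p (∑ k, frameD m σ k (J k)) ∂(halfMeasure m)
      = - ∫ x : Space m, (ev (x, 0) (J none) - σ * ev (x, 0) (J (some none))) := by
  have hi : ∀ k, Integrable (fun p => ev p (frameD m σ k (J k))) (halfMeasure m) := fun k => by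
    have := integrable_indicator_of_bddOn isOpen_univ ((hJ k).dirD isOpen_univ (frame m σ k))
    rwa [indicator_univ] at this
  have hsl : ∀ k, Integrable (fun x : Space m => ev (x, 0) (J k)) := fun k =>
    integrable_slice_of_bddOn (hJ k)
  simp only [map_sum]
  rw [integral_finsetSum _ (fun k _ => hi k)]
  have hk : ∀ k, ∫ p, ev p (frameD m σ k (J k)) ∂(halfMeasure m)
      = -((frame m σ k).2 * ∫ x : Space m, ev (x, 0) (J k)) := fun k => by
    have := integral_dirD isOpen_univ (hJ k) (fun p _ hp => by simp at hp) (frame m σ k)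
    rw [indicator_univ, indicator_univ] at this
    exact this
  simp only [hk, Fintype.sum_option]
  rw [integral_sub (hsl _) ((hsl _).const_mul _), integral_const_mul]
  simp only [frame, one_mul, neg_mul, zero_mul, neg_zero, Finset.sum_const_zero, add_zero,
    neg_neg]
  ring

/-- The phase `ψ = (5 |x - (6/5) e|² - s²) / 2`. -/
noncomputable def phase (m : ℕ) : smoothAlg m :=
  algebraMap ℝ _ (1 / 2) * (algebraMap ℝ _ 5 *
    (∑ i, coordY i ^ 2 + (coordZ - algebraMap ℝ _ (6 / 5)) ^ 2) - coordS ^ 2)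

theorem ev_phase (p : SpaceTime m) :
    ev p (phase m) = 1 / 2 * (5 * (∑ i, p.1.1 i ^ 2 + (p.1.2 - 6 / 5) ^ 2) - p.2 ^ 2) := by
  simp [phase]

theorem dirD_phase (e : SpaceTime m) :
    dirD e (phase m) = algebraMap ℝ _ 5 * (∑ i, coordY i * dirD e (coordY i)
      + (coordZ - algebraMap ℝ _ (6 / 5)) * dirD e coordZ) - coordS * dirD e coordS := by
  have h : algebraMap ℝ (smoothAlg m) (1 / 2) * 2 = 1 := by
    rw [← map_ofNat (algebraMap ℝ (smoothAlg m)) 2, ← map_mul]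
    norm_num
  have hs : ∑ i : Fin m, dirD e (coordY i ^ 2) = 2 * ∑ i, coordY i * dirD e (coordY i) := by
    rw [Finset.mul_sum]
    refine Finset.sum_congr rfl fun i _ => ?_
    simp only [Derivation.leibniz_pow, smul_eq_mul, nsmul_eq_mul]
    push_cast
    ring
  simp only [phase, Derivation.leibniz, map_sub, map_add, map_sum, Derivation.map_algebraMap,
    smul_eq_mul, hs]
  simp only [Derivation.leibniz_pow, smul_eq_mul, nsmul_eq_mul, map_sub, Derivation.map_algebraMap]
  push_cast
  linear_combination (algebraMap ℝ (smoothAlg m) 5 * (∑ i, coordY i * dirD e (coordY i)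
      + (coordZ - algebraMap ℝ _ (6 / 5)) * dirD e coordZ) - coordS * dirD e coordS) * h

theorem ev_dirD_phase (e : SpaceTime m) {p : SpaceTime m} (hp : p ∈ halfSpace m) :
    ev p (dirD e (phase m))
      = 5 * (∑ i, p.1.1 i * e.1.1 i + (p.1.2 - 6 / 5) * e.1.2) - p.2 * e.2 := by
  have h1 : ∀ i : Fin m, ev p (dirD e (coordY i)) = e.1.1 i := fun i => ev_dirD_linElt _ e hp
  have h2 : ev p (dirD e coordZ) = e.1.2 := ev_dirD_linElt _ e hp
  have h3 : ev p (dirD e coordS) = e.2 := ev_dirD_linElt _ e hp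
  rw [dirD_phase]
  simp [h1, h2, h3]

theorem ev_dirD_dirD_phase (e e' : SpaceTime m) {p : SpaceTime m} (hp : p ∈ halfSpace m) :
    ev p (dirD e' (dirD e (phase m)))
      = 5 * (∑ i, e'.1.1 i * e.1.1 i + e'.1.2 * e.1.2) - e'.2 * e.2 := by
  have h1 : ∀ (e : SpaceTime m) (i : Fin m), ev p (dirD e (coordY i)) = e.1.1 i :=
    fun e i => ev_dirD_linElt _ e hp
  have h2 : ∀ e : SpaceTime m, ev p (dirD e coordZ) = e.1.2 := fun e => ev_dirD_linElt _ e hp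
  have h3 : ∀ e : SpaceTime m, ev p (dirD e coordS) = e.2 := fun e => ev_dirD_linElt _ e hp
  have h4 : ∀ i : Fin m, ev p (dirD e' (dirD e (coordY i))) = 0 :=
    fun i => ev_dirD_dirD_linElt _ e e' hp
  have h5 : ev p (dirD e' (dirD e coordZ)) = 0 := ev_dirD_dirD_linElt _ e e' hp
  have h6 : ev p (dirD e' (dirD e coordS)) = 0 := ev_dirD_dirD_linElt _ e e' hp
  rw [dirD_phase]
  simp [h1, h2, h3, h4, h5, h6, Derivation.leibniz, mul_comm]

/-- The weight `φ = exp (50 ψ)`. -/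
noncomputable def weight (m : ℕ) : smoothAlg m := expElt (algebraMap ℝ _ 50 * phase m)

theorem ev_weight (p : SpaceTime m) : ev p (weight m) = Real.exp (50 * ev p (phase m)) := by
  simp [weight, ev_expElt]

theorem ev_weight_pos (p : SpaceTime m) : 0 < ev p (weight m) := by
  rw [ev_weight]; positivity

theorem dirD_weight (e : SpaceTime m) :
    dirD e (weight m) = algebraMap ℝ _ 50 * (weight m * dirD e (phase m)) := by
  rw [weight, dirD_expElt]
  simp only [Derivation.leibniz, Derivation.map_algebraMap, smul_eq_mul]
  ring

theorem dirD_dirD_weight (e e' : SpaceTime m) :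
    dirD e' (dirD e (weight m)) = algebraMap ℝ _ 50 * (weight m * (dirD e' (dirD e (phase m))
      + algebraMap ℝ _ 50 * (dirD e' (phase m) * dirD e (phase m)))) := by
  rw [dirD_weight]
  simp only [Derivation.leibniz, Derivation.map_algebraMap, smul_eq_mul, dirD_weight]
  ring

theorem ev_gradForm (σ : ℝ) (f g : smoothAlg m) (p : SpaceTime m) :
    ev p (gradForm (frameD m σ) waveSign f g)
      = ∑ i : Fin m, ev p (frameD m σ (some (some i)) f) * ev p (frameD m σ (some (some i)) g)
        + ev p (frameD m σ (some none) f) * ev p (frameD m σ (some none) g)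
        - ev p (frameD m σ none f) * ev p (frameD m σ none g) := by
  simp only [gradForm, Fintype.sum_option, waveSign, map_add, map_mul, map_sum, map_one,
    ev_algebraMap]
  ring_nf

theorem ev_gradSq (σ : ℝ) (f : smoothAlg m) (p : SpaceTime m) :
    ev p (gradSq (frameD m σ) f)
      = ∑ i : Fin m, ev p (frameD m σ (some (some i)) f) ^ 2
        + ev p (frameD m σ (some none) f) ^ 2 + ev p (frameD m σ none f) ^ 2 := by
  simp only [gradSq, Fintype.sum_option, map_add, map_pow, map_sum]
  ring_nf

theorem gradForm_weight_left (σ : ℝ) (f : smoothAlg m) :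
    gradForm (frameD m σ) waveSign (weight m) f
      = algebraMap ℝ _ 50 * weight m * gradForm (frameD m σ) waveSign (phase m) f := by
  simp only [gradForm, frameD, dirD_weight, Finset.mul_sum]
  exact Finset.sum_congr rfl fun k _ => by ring

theorem gradForm_comm (σ : ℝ) (f g : smoothAlg m) :
    gradForm (frameD m σ) waveSign f g = gradForm (frameD m σ) waveSign g f := by
  simp only [gradForm, mul_comm]

theorem gradForm_weight_weight (σ : ℝ) :
    gradForm (frameD m σ) waveSign (weight m) (weight m)
      = (algebraMap ℝ _ 50 * weight m) ^ 2 * gradForm (frameD m σ) waveSign (phase m) (phase m) := by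
  rw [gradForm_weight_left, gradForm_comm, gradForm_weight_left]
  ring

theorem hessForm_weight (σ : ℝ) (f : smoothAlg m) :
    hessForm (frameD m σ) waveSign (weight m) f
      = algebraMap ℝ _ 50 * weight m * (hessForm (frameD m σ) waveSign (phase m) f
        + algebraMap ℝ _ 50 * gradForm (frameD m σ) waveSign (phase m) f ^ 2) := by
  rw [gradForm, sq, Finset.sum_mul_sum]
  simp only [hessForm, frameD, dirD_dirD_weight, Finset.mul_sum, ← Finset.sum_add_distrib]
  exact Finset.sum_congr rfl fun k _ => Finset.sum_congr rfl fun l _ => by ring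

theorem ev_hessForm_phase {σ : ℝ} (hσ : σ ^ 2 = 1) (f : smoothAlg m) {p : SpaceTime m}
    (hp : p ∈ halfSpace m) :
    ev p (hessForm (frameD m σ) waveSign (phase m) f)
      = 5 * ∑ i : Fin m, ev p (frameD m σ (some (some i)) f) ^ 2
        + 5 * ev p (frameD m σ (some none) f) ^ 2
        - (ev p (frameD m σ (some none) f) + σ * ev p (frameD m σ none f)) ^ 2 := by
  have hh : ∀ k l, ev p (frameD m σ k (frameD m σ l (phase m)))
      = 5 * (∑ i, (frame m σ k).1.1 i * (frame m σ l).1.1 i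
        + (frame m σ k).1.2 * (frame m σ l).1.2) - (frame m σ k).2 * (frame m σ l).2 :=
    fun k l => ev_dirD_dirD_phase _ _ hp
  simp only [hessForm, map_sum, map_mul, ev_algebraMap, hh]
  simp only [Fintype.sum_option, waveSign, frame]
  have hs : ∀ i j : Fin m, ∑ l, (EuclideanSpace.single i (1 : ℝ)) l
      * (EuclideanSpace.single j (1 : ℝ)) l = if i = j then 1 else 0 := by
    intro i j
    simp [eq_comm]
  simp only [hs]
  simp
  simp only [← Finset.mul_sum, ← sq]
  linear_combination (ev p (frameD m σ none f) ^ 2 - ev p (frameD m σ (some none) f) ^ 2) * hσ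

theorem ev_frameD_phase_none (σ : ℝ) {p : SpaceTime m} (hp : p ∈ halfSpace m) :
    ev p (frameD m σ none (phase m)) = -p.2 := by
  rw [frameD, ev_dirD_phase _ hp]
  simp [frame]

theorem ev_frameD_phase_z (σ : ℝ) {p : SpaceTime m} (hp : p ∈ halfSpace m) :
    ev p (frameD m σ (some none) (phase m)) = 5 * (p.1.2 - 6 / 5) + σ * p.2 := by
  rw [frameD, ev_dirD_phase _ hp]
  simp [frame]
  ring

theorem ev_frameD_phase_y (σ : ℝ) (i : Fin m) {p : SpaceTime m} (hp : p ∈ halfSpace m) :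
    ev p (frameD m σ (some (some i)) (phase m)) = 5 * p.1.1 i := by
  rw [frameD, ev_dirD_phase _ hp]
  simp [frame]

theorem ev_gradForm_phase {σ : ℝ} (hσ : σ ^ 2 = 1) {p : SpaceTime m} (hp : p ∈ halfSpace m) :
    ev p (gradForm (frameD m σ) waveSign (phase m) (phase m))
      = 25 * (∑ i, p.1.1 i ^ 2 + (p.1.2 - 6 / 5) ^ 2) + 10 * σ * (p.1.2 - 6 / 5) * p.2 := by
  rw [ev_gradForm]
  simp only [ev_frameD_phase_none σ hp, ev_frameD_phase_z σ hp, ev_frameD_phase_y σ _ hp]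
  have : ∑ i : Fin m, 5 * p.1.1 i * (5 * p.1.1 i) = 25 * ∑ i, p.1.1 i ^ 2 := by
    rw [Finset.mul_sum]
    exact Finset.sum_congr rfl fun i _ => by ring
  rw [this]
  linear_combination p.2 ^ 2 * hσ

theorem hessForm_phase_weight (σ : ℝ) :
    hessForm (frameD m σ) waveSign (phase m) (weight m)
      = (algebraMap ℝ _ 50 * weight m) ^ 2 * hessForm (frameD m σ) waveSign (phase m) (phase m) := by
  simp only [hessForm, frameD, dirD_weight, Finset.mul_sum]
  exact Finset.sum_congr rfl fun k _ => Finset.sum_congr rfl fun l _ => by ring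

theorem ev_hessForm_phase_phase {σ : ℝ} (hσ : σ ^ 2 = 1) {p : SpaceTime m}
    (hp : p ∈ halfSpace m) :
    ev p (hessForm (frameD m σ) waveSign (phase m) (phase m))
      = 5 * ev p (gradForm (frameD m σ) waveSign (phase m) (phase m)) + 5 * p.2 ^ 2
        - 25 * (p.1.2 - 6 / 5) ^ 2 := by
  rw [ev_hessForm_phase hσ _ hp, ev_gradForm_phase hσ hp]
  simp only [ev_frameD_phase_none σ hp, ev_frameD_phase_z σ hp, ev_frameD_phase_y σ _ hp]
  have : ∑ i : Fin m, (5 * p.1.1 i) ^ 2 = 25 * ∑ i, p.1.1 i ^ 2 := by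
    rw [Finset.mul_sum]
    exact Finset.sum_congr rfl fun i _ => by ring
  rw [this]
  linear_combination 5 * p.2 ^ 2 * hσ

theorem weight_convexity {σ : ℝ} (hσ : σ ^ 2 = 1) (w : smoothAlg m) {p : SpaceTime m}
    (hp : p ∈ halfSpace m) :
    25 * ev p (weight m) * ev p (gradSq (frameD m σ) w)
      ≤ ev p (hessForm (frameD m σ) waveSign (weight m) w)
        - 125 * ev p (weight m) * ev p (gradForm (frameD m σ) waveSign w w) := by
  rw [hessForm_weight, ev_gradSq, ev_gradForm]
  simp only [map_mul, map_add, map_pow, ev_algebraMap, ev_hessForm_phase hσ w hp, ← sq]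
  have h0 := ev_weight_pos p
  set Φ := ev p (weight m)
  set a := ∑ i : Fin m, ev p (frameD m σ (some (some i)) w) ^ 2
  have ha : 0 ≤ a := Finset.sum_nonneg fun i _ => sq_nonneg _
  set b := ev p (frameD m σ (some none) w)
  set d := ev p (frameD m σ none w)
  set g := ev p (gradForm (frameD m σ) waveSign (phase m) w)
  have key : 0 ≤ (5 * a + 5 * b ^ 2 - (b + σ * d) ^ 2 + 50 * g ^ 2)
      - 5 / 2 * (a + b ^ 2 - d ^ 2) - 1 / 2 * (a + b ^ 2 + d ^ 2) := by
    have h1 : (σ * d) ^ 2 = d ^ 2 := by rw [mul_pow, hσ, one_mul]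
    nlinarith [sq_nonneg (b - σ * d), sq_nonneg g]
  nlinarith [mul_nonneg h0.le key]

theorem weight_pseudoconvexity {σ : ℝ} (hσ : σ ^ 2 = 1) {p : SpaceTime m}
    (hp : p ∈ halfSpace m) (hx : normSq p.1 ≤ 1) :
    15625 * ev p (weight m) ^ 3
      ≤ ev p (hessForm (frameD m σ) waveSign (weight m) (weight m))
        + 125 * ev p (weight m) * ev p (gradForm (frameD m σ) waveSign (weight m) (weight m)) := by
  have hgpw : gradForm (frameD m σ) waveSign (phase m) (weight m)
      = algebraMap ℝ _ 50 * weight m * gradForm (frameD m σ) waveSign (phase m) (phase m) := by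
    rw [gradForm_comm, gradForm_weight_left]
  rw [hessForm_weight, hessForm_phase_weight, gradForm_weight_weight, hgpw]
  simp only [map_mul, map_add, map_pow, ev_algebraMap, ev_hessForm_phase_phase hσ hp]
  have h0 := ev_weight_pos p
  have hG := ev_gradForm_phase hσ hp
  set Φ := ev p (weight m)
  set G := ev p (gradForm (frameD m σ) waveSign (phase m) (phase m))
  set Z := p.1.2 - 6 / 5 with hZ
  set Y := ∑ i, p.1.1 i ^ 2 with hY
  have hY0 : 0 ≤ Y := Finset.sum_nonneg fun i _ => sq_nonneg _
  have hz1 : p.1.2 ≤ 1 := by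
    have : Y + p.1.2 ^ 2 ≤ 1 := hx
    nlinarith
  have hZ2 : 1 / 25 ≤ Z ^ 2 := by nlinarith
  have key : 0 ≤ 5 * G + 5 * p.2 ^ 2 - 25 * Z ^ 2 + 50 * G ^ 2 + 5 / 2 * G - 1 / 8 := by
    set X := Y + Z ^ 2 with hX
    have hX0 : 1 / 25 ≤ X := by linarith
    have h1 : (G - 25 * X) ^ 2 = 100 * (Z ^ 2 * p.2 ^ 2) := by
      rw [hG]
      linear_combination 100 * Z ^ 2 * p.2 ^ 2 * hσ
    have h2 : Z ^ 2 * p.2 ^ 2 ≤ X * p.2 ^ 2 :=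
      mul_le_mul_of_nonneg_right (by linarith) (sq_nonneg _)
    have h3 : 0 ≤ X * (5 * G + 50 * G ^ 2 + 25 / 4 * X - 1 / 8) := by
      refine mul_nonneg (by linarith) ?_
      nlinarith [sq_nonneg (G + 1 / 20)]
    have h4 : X * Z ^ 2 ≤ X * X := mul_le_mul_of_nonneg_left (by linarith) (by linarith)
    have h5 : 0 ≤ X * (5 * G + 5 * p.2 ^ 2 - 25 * Z ^ 2 + 50 * G ^ 2 + 5 / 2 * G - 1 / 8) := by
      nlinarith [sq_nonneg G]
    exact nonneg_of_mul_nonneg_right h5 (by linarith)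
  have h3 : 0 < Φ ^ 3 := by positivity
  nlinarith [mul_nonneg h3.le key]

/-- The modified zeroth order coefficient `Lφ - 250 φ`. -/
noncomputable def weightCoeff (m : ℕ) (σ : ℝ) : smoothAlg m :=
  quadOp (frameD m σ) waveSign (weight m) - algebraMap ℝ _ 250 * weight m

/-- The conjugated wave operator. -/
noncomputable def conjOp (m : ℕ) (σ τ : ℝ) (w : smoothAlg m) : smoothAlg m :=
  quadOp (frameD m σ) waveSign w
    + algebraMap ℝ _ τ ^ 2 * gradForm (frameD m σ) waveSign (weight m) (weight m) * w
    - 2 * algebraMap ℝ _ τ * gradForm (frameD m σ) waveSign (weight m) w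
    - algebraMap ℝ _ τ * quadOp (frameD m σ) waveSign (weight m) * w

/-- The divergence of the Carleman flux. -/
noncomputable def fluxDiv (m : ℕ) (σ τ : ℝ) (w : smoothAlg m) : smoothAlg m :=
  ∑ k, frameD m σ k (carlemanFlux (frameD m σ) waveSign (algebraMap ℝ _ τ) (weight m)
    (weightCoeff m σ) w k)

theorem carleman_pointwise {σ τ : ℝ} (hσ : σ ^ 2 = 1) (hτ : 0 ≤ τ) (w : smoothAlg m)
    {p : SpaceTime m} (hp : p ∈ halfSpace m) (hx : normSq p.1 ≤ 1) :
    ev p (fluxDiv m σ τ w) + 100 * τ * ev p (weight m) * ev p (gradSq (frameD m σ) w)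
      + (62500 * τ ^ 3 * ev p (weight m) ^ 3
        - τ * |ev p (quadOp (frameD m σ) waveSign (weightCoeff m σ))|
        - 125000 * τ ^ 2 * ev p (weight m) ^ 2) * ev p w ^ 2
      ≤ 2 * ev p (conjOp m σ τ w) ^ 2 := by
  have hid := congrArg (ev p) (carleman_identity (frameD m σ) (fun k l f => frameD_comm σ k l f)
    waveSign τ (algebraMap ℝ _ τ) (weight m) (weightCoeff m σ) w rfl)
  have h1 := weight_convexity hσ w hp
  have h2 := weight_pseudoconvexity hσ hp hx
  have hθ : ev p (weightCoeff m σ)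
      = ev p (quadOp (frameD m σ) waveSign (weight m)) - 250 * ev p (weight m) := by
    simp only [weightCoeff, map_sub, map_mul, ev_algebraMap]
  rw [← fluxDiv] at hid
  rw [hid]
  simp only [conjOp, map_sub, map_add, map_neg, map_mul, map_pow, map_ofNat, ev_algebraMap, hθ]
  set Φ := ev p (weight m)
  set Lw := ev p (quadOp (frameD m σ) waveSign w)
  set G := ev p (gradForm (frameD m σ) waveSign (weight m) (weight m))
  set M := ev p (gradForm (frameD m σ) waveSign (weight m) w)
  set N := ev p (gradForm (frameD m σ) waveSign w w)
  set Lφ := ev p (quadOp (frameD m σ) waveSign (weight m))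
  set Lθ := ev p (quadOp (frameD m σ) waveSign (weightCoeff m σ))
  set Hw := ev p (hessForm (frameD m σ) waveSign (weight m) w)
  set Hφ := ev p (hessForm (frameD m σ) waveSign (weight m) (weight m))
  set g := ev p (gradSq (frameD m σ) w)
  set W := ev p w
  set A := Lw + τ ^ 2 * G * W with hA
  set B := -(2 * τ * M) - τ * (Lφ - 250 * Φ) * W with hB
  have h3 : Lw + τ ^ 2 * G * W - 2 * τ * M - τ * Lφ * W = A + B - 250 * τ * Φ * W := by
    rw [hA, hB]; ring
  rw [h3]
  have h4 := mul_le_mul_of_nonneg_left h1 hτ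
  have h5 := mul_le_mul_of_nonneg_left h2 (by positivity : 0 ≤ τ ^ 3 * W ^ 2)
  have h6 : τ * W ^ 2 * Lθ ≤ τ * W ^ 2 * |Lθ| :=
    mul_le_mul_of_nonneg_left (le_abs_self _) (by positivity)
  have h7 : 2 * A * B ≤ 2 * (A + B - 250 * τ * Φ * W) ^ 2 + 2 * (250 * τ * Φ * W) ^ 2 := by
    nlinarith [sq_nonneg A, sq_nonneg B, sq_nonneg (A + B - 2 * (250 * τ * Φ * W))]
  nlinarith

/-- The region containing the supports of the functions to which the Carleman estimate applies. -/
def carlemanRegion (m : ℕ) : Set (SpaceTime m) := {p | 0 ≤ p.2 ∧ normSq p.1 ≤ 1 ∧ p.2 ≤ 6}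

theorem norm_le_of_normSq_le {x : Space m} {r : ℝ} (hr : 0 ≤ r) (h : normSq x ≤ r ^ 2) :
    ‖x‖ ≤ r := by
  rw [normSq_eq] at h
  rw [Prod.norm_def]
  refine max_le ?_ ?_
  · exact abs_le_of_sq_le_sq' (by nlinarith [sq_nonneg x.2]) hr |>.2
  · rw [Real.norm_eq_abs]
    exact abs_le_of_sq_le_sq (by nlinarith [sq_nonneg ‖x.1‖]) hr

theorem isCompact_carlemanRegion (m : ℕ) : IsCompact (carlemanRegion m) := by
  refine (isCompact_closedBall (0 : SpaceTime m) 6).of_isClosed_subset ?_ ?_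
  · refine (isClosed_le continuous_const continuous_snd).inter
      ((isClosed_le (continuous_normSq.comp continuous_fst) continuous_const).inter
        (isClosed_le continuous_snd continuous_const))
  · rintro p ⟨h1, h2, h3⟩
    rw [mem_closedBall_zero_iff, Prod.norm_def]
    refine max_le ?_ ?_
    · exact (norm_le_of_normSq_le zero_le_one (by simpa using h2)).trans (by norm_num)
    · rw [Real.norm_eq_abs, abs_of_nonneg h1]
      exact h3

theorem carlemanRegion_subset : carlemanRegion m ⊆ halfSpace m := fun _ hp => hp.1

theorem exists_bound_carlemanRegion (f : smoothAlg m) :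
    ∃ C, 0 < C ∧ ∀ p ∈ carlemanRegion m, |ev p f| ≤ C := by
  obtain ⟨C, hC⟩ := (isCompact_carlemanRegion m).exists_bound_of_continuousOn
    ((continuousOn_ev f).mono carlemanRegion_subset)
  exact ⟨max C 1, by positivity, fun p hp => (hC p hp).trans (le_max_left _ _)⟩

theorem exists_pos_le_weight (m : ℕ) : ∃ a, 0 < a ∧ ∀ p ∈ carlemanRegion m, a ≤ ev p (weight m) := by
  refine ⟨Real.exp (50 * -18), Real.exp_pos _, ?_⟩
  rintro p ⟨h1, h2, h3⟩
  rw [ev_weight, ev_phase]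
  have : 0 ≤ ∑ i, p.1.1 i ^ 2 := Finset.sum_nonneg fun i _ => sq_nonneg _
  refine Real.exp_le_exp.2 ?_
  nlinarith [sq_nonneg (p.1.2 - 6 / 5)]

theorem carleman_pointwise_uniform (m : ℕ) {σ : ℝ} (hσ : σ ^ 2 = 1) :
    ∃ c τ₀ : ℝ, 0 < c ∧ 1 ≤ τ₀ ∧ ∀ τ, τ₀ ≤ τ → ∀ (w : smoothAlg m), ∀ p ∈ carlemanRegion m,
      ev p (fluxDiv m σ τ w) + c * (τ * ev p (gradSq (frameD m σ) w) + τ ^ 3 * ev p w ^ 2)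
      ≤ 2 * ev p (conjOp m σ τ w) ^ 2 := by
  obtain ⟨a, ha, hwa⟩ := exists_pos_le_weight m
  obtain ⟨b, hb, hwb⟩ := exists_bound_carlemanRegion (weight m)
  obtain ⟨Q, hQ, hwQ⟩ := exists_bound_carlemanRegion
    (quadOp (frameD m σ) waveSign (weightCoeff m σ))
  refine ⟨min (100 * a) (31250 * a ^ 3), max 1 ((Q + 125000 * b ^ 2) / (31250 * a ^ 3)),
    by positivity, le_max_left _ _, ?_⟩
  intro τ hτ w p hp
  have hτ1 : 1 ≤ τ := (le_max_left _ _).trans hτ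
  have hτ2 : Q + 125000 * b ^ 2 ≤ τ * (31250 * a ^ 3) := by
    rw [← div_le_iff₀ (by positivity)]
    exact (le_max_right _ _).trans hτ
  have key := carleman_pointwise hσ (by linarith : 0 ≤ τ) w hp.1 hp.2.1
  have hg : 0 ≤ ev p (gradSq (frameD m σ) w) := by
    rw [ev_gradSq]
    have : 0 ≤ ∑ i : Fin m, ev p (frameD m σ (some (some i)) w) ^ 2 :=
      Finset.sum_nonneg fun i _ => sq_nonneg _
    positivity
  have hΦa := hwa p hp
  have hΦb : ev p (weight m) ≤ b := (le_abs_self _).trans (hwb p hp)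
  have hΦ0 := ev_weight_pos p
  have hLθ := hwQ p hp
  set Φ := ev p (weight m)
  set g := ev p (gradSq (frameD m σ) w)
  set W := ev p w
  set Lθ := ev p (quadOp (frameD m σ) waveSign (weightCoeff m σ))
  have h1 : min (100 * a) (31250 * a ^ 3) * (τ * g) ≤ 100 * Φ * (τ * g) := by
    refine mul_le_mul_of_nonneg_right ((min_le_left _ _).trans (by linarith)) (by positivity)
  have h2 : 31250 * a ^ 3 * τ ^ 3 ≤ 62500 * τ ^ 3 * Φ ^ 3 - τ * |Lθ| - 125000 * τ ^ 2 * Φ ^ 2 := by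
    have i1 : a ^ 3 ≤ Φ ^ 3 := by gcongr
    have i2 : Φ ^ 2 ≤ b ^ 2 := by gcongr
    have i3 : τ ^ 3 * a ^ 3 ≤ τ ^ 3 * Φ ^ 3 := by gcongr
    have i4 : τ * |Lθ| ≤ τ ^ 2 * Q := by
      have : τ * 1 ≤ τ * τ := by gcongr
      calc τ * |Lθ| ≤ τ * Q := by gcongr
        _ ≤ τ ^ 2 * Q := by nlinarith
    have i5 : τ ^ 2 * Φ ^ 2 ≤ τ ^ 2 * b ^ 2 := by gcongr
    have i6 := mul_le_mul_of_nonneg_left hτ2 (by positivity : 0 ≤ τ ^ 2)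
    nlinarith
  have h3 : min (100 * a) (31250 * a ^ 3) * (τ ^ 3 * W ^ 2)
      ≤ (62500 * τ ^ 3 * Φ ^ 3 - τ * |Lθ| - 125000 * τ ^ 2 * Φ ^ 2) * W ^ 2 := by
    have j1 : min (100 * a) (31250 * a ^ 3) * τ ^ 3 ≤ 31250 * a ^ 3 * τ ^ 3 := by
      gcongr; exact min_le_right _ _
    calc _ = min (100 * a) (31250 * a ^ 3) * τ ^ 3 * W ^ 2 := by ring
      _ ≤ _ := mul_le_mul_of_nonneg_right (j1.trans h2) (sq_nonneg _)
  linarith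

/-- The functions vanishing outside of the Carleman region. -/
def vanishIdeal (m : ℕ) : Ideal (smoothAlg m) where
  carrier := {f | ∀ p ∈ halfSpace m, p ∉ carlemanRegion m → ev p f = 0}
  add_mem' {f g} hf hg p hp hp' := by rw [map_add, hf p hp hp', hg p hp hp', add_zero]
  zero_mem' p _ _ := map_zero _
  smul_mem' g f hf p hp hp' := by rw [smul_eq_mul, map_mul, hf p hp hp', mul_zero]

theorem dirD_mem_vanishIdeal {f : smoothAlg m} (hf : f ∈ vanishIdeal m) (e : SpaceTime m) :
    dirD e f ∈ vanishIdeal m := by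
  intro p hp hp'
  have := ev_dirD_congr e (f := f) (g := 0) (isCompact_carlemanRegion m).isClosed.isOpen_compl
    (fun p hp' hp => by rw [hf p hp hp', map_zero]) p hp' hp
  simpa using this

theorem bddOn_of_mem_vanishIdeal {f : smoothAlg m} (hf : f ∈ vanishIdeal m) : BddOn univ 6 f := by
  intro p hp _ hpn
  refine hf p hp fun hp' => ?_
  have h1 : ‖p.1‖ ≤ 1 := norm_le_of_normSq_le zero_le_one (by simpa using hp'.2.1)
  have h2 : ‖p.2‖ ≤ 6 := by rw [Real.norm_eq_abs, abs_of_nonneg hp'.1]; exact hp'.2.2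
  rw [Prod.norm_def, lt_max_iff] at hpn
  rcases hpn with h | h <;> linarith

theorem integrable_of_mem_vanishIdeal {f : smoothAlg m} (hf : f ∈ vanishIdeal m) :
    Integrable (fun p => ev p f) (halfMeasure m) := by
  have := integrable_indicator_of_bddOn isOpen_univ (bddOn_of_mem_vanishIdeal hf)
  rwa [indicator_univ] at this

theorem integrable_slice_of_mem_vanishIdeal {f : smoothAlg m} (hf : f ∈ vanishIdeal m) :
    Integrable (fun x : Space m => ev (x, 0) f) :=
  integrable_slice_of_bddOn (bddOn_of_mem_vanishIdeal hf)

theorem quadOp_mem_vanishIdeal {f : smoothAlg m} (hf : f ∈ vanishIdeal m) (σ : ℝ) :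
    quadOp (frameD m σ) waveSign f ∈ vanishIdeal m :=
  Ideal.sum_mem _ fun _ _ => Ideal.mul_mem_left _ _
    (dirD_mem_vanishIdeal (dirD_mem_vanishIdeal hf _) _)

theorem gradForm_mem_vanishIdeal {f : smoothAlg m} (hf : f ∈ vanishIdeal m) (σ : ℝ)
    (g : smoothAlg m) : gradForm (frameD m σ) waveSign g f ∈ vanishIdeal m :=
  Ideal.sum_mem _ fun _ _ => Ideal.mul_mem_left _ _
    (Ideal.mul_mem_left _ _ (dirD_mem_vanishIdeal hf _))

theorem gradSq_mem_vanishIdeal {f : smoothAlg m} (hf : f ∈ vanishIdeal m) (σ : ℝ) :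
    gradSq (frameD m σ) f ∈ vanishIdeal m :=
  Ideal.sum_mem _ fun _ _ => Ideal.pow_mem_of_mem _ (dirD_mem_vanishIdeal hf _) 2 two_pos

theorem carlemanFlux_mem_vanishIdeal {w : smoothAlg m} (hw : w ∈ vanishIdeal m) (σ : ℝ)
    (τ φ θ : smoothAlg m) (k) : carlemanFlux (frameD m σ) waveSign τ φ θ w k ∈ vanishIdeal m := by
  have h1 : frameD m σ k w ∈ vanishIdeal m := dirD_mem_vanishIdeal hw _
  have h2 : w ^ 2 ∈ vanishIdeal m := Ideal.pow_mem_of_mem _ hw 2 two_pos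
  refine Ideal.mul_mem_left _ _ (add_mem (sub_mem (sub_mem (add_mem (neg_mem ?_) ?_) ?_) ?_) ?_)
  · exact Ideal.mul_mem_left _ _ (Ideal.mul_mem_right _ _ h1)
  · exact Ideal.mul_mem_left _ _ (Ideal.mul_mem_left _ _ (gradForm_mem_vanishIdeal hw σ w))
  · exact Ideal.mul_mem_left _ _ (Ideal.mul_mem_left _ _ h2)
  · exact Ideal.mul_mem_left _ _ (Ideal.mul_mem_left _ _ h1)
  · exact Ideal.mul_mem_left _ _ (Ideal.mul_mem_left _ _ h2)

theorem conjOp_mem_vanishIdeal {w : smoothAlg m} (hw : w ∈ vanishIdeal m) (σ τ : ℝ) :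
    conjOp m σ τ w ∈ vanishIdeal m :=
  sub_mem (sub_mem (add_mem (quadOp_mem_vanishIdeal hw σ) (Ideal.mul_mem_left _ _ hw))
    (Ideal.mul_mem_left _ _ (gradForm_mem_vanishIdeal hw σ _))) (Ideal.mul_mem_left _ _ hw)

/-- The part of the boundary flux that is determined by the restrictions to `s = 0`. -/
noncomputable def sliceFlux (τ : ℝ) (w θ : smoothAlg m) (x : Space m) : ℝ :=
  let φ := weight m;
  let Y (f : smoothAlg m) (i : Fin m) := ev (x, 0) (dirD ((EuclideanSpace.single i 1, 0), 0) f);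
  let Z (f : smoothAlg m) := ev (x, 0) (dirD ((0, 1), 0) f);
  -(4 * τ * (Z w * (∑ i, Y φ i * Y w i + Z φ * Z w)))
    + 2 * τ * (Z φ * (∑ i, Y w i * Y w i + Z w * Z w))
    - 2 * τ ^ 3 * ((∑ i, Y φ i * Y φ i + Z φ * Z φ) * Z φ * ev (x, 0) w ^ 2)
    - 2 * τ * (ev (x, 0) θ * ev (x, 0) w * Z w) + τ * (Z θ * ev (x, 0) w ^ 2)

theorem boundaryFlux_eq {σ : ℝ} (hσ : σ ^ 2 = 1) (τ : ℝ) (w θ : smoothAlg m) (x : Space m) :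
    ev (x, 0) (carlemanFlux (frameD m σ) waveSign (algebraMap ℝ _ τ) (weight m) θ w none)
      - σ * ev (x, 0)
        (carlemanFlux (frameD m σ) waveSign (algebraMap ℝ _ τ) (weight m) θ w (some none))
      = -(σ * sliceFlux τ w θ x) := by
  have hx : ((x, 0) : SpaceTime m) ∈ halfSpace m := le_refl (0 : ℝ)
  have hφt : ev (x, 0) (frameD m σ none (weight m)) = 0 := by
    rw [frameD, dirD_weight, map_mul, map_mul, ← frameD, ev_frameD_phase_none σ hx]
    simp
  have hY : ∀ (f : smoothAlg m) (i : Fin m), dirD ((EuclideanSpace.single i 1, 0), 0) f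
      = frameD m σ (some (some i)) f := fun f i => rfl
  have hZ : ∀ f : smoothAlg m, ev (x, 0) (dirD ((0, 1), 0) f)
      = ev (x, 0) (frameD m σ (some none) f) + σ * ev (x, 0) (frameD m σ none f) := fun f => by
    rw [dirD_z_eq σ, map_add, map_smul, smul_eq_mul]
  simp only [sliceFlux, hY, hZ, carlemanFlux, map_add, map_sub, map_neg, map_mul, map_pow,
    map_ofNat, ev_algebraMap, ev_gradForm, waveSign, hφt]
  set mS := ∑ i : Fin m, ev (x, 0) (frameD m σ (some (some i)) (weight m))
    * ev (x, 0) (frameD m σ (some (some i)) w)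
  set nS := ∑ i : Fin m, ev (x, 0) (frameD m σ (some (some i)) w)
    * ev (x, 0) (frameD m σ (some (some i)) w)
  set gS := ∑ i : Fin m, ev (x, 0) (frameD m σ (some (some i)) (weight m))
    * ev (x, 0) (frameD m σ (some (some i)) (weight m))
  set a := ev (x, 0) (frameD m σ (some none) w)
  set b := ev (x, 0) (frameD m σ none w)
  set P := ev (x, 0) (frameD m σ (some none) (weight m))
  set W := ev (x, 0) w
  set Θ := ev (x, 0) θ
  set u := ev (x, 0) (frameD m σ (some none) θ)
  set v := ev (x, 0) (frameD m σ none θ)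
  linear_combination (τ * v * W ^ 2 - 2 * τ * Θ * W * b - 4 * τ * (mS + P * a) * b
    - 2 * τ * P * σ * b ^ 2) * hσ

theorem ev_quadOp_phase {σ : ℝ} (hσ : σ ^ 2 = 1) {p : SpaceTime m} (hp : p ∈ halfSpace m) :
    ev p (quadOp (frameD m σ) waveSign (phase m)) = 5 * (m + 1) := by
  have hh : ∀ k, ev p (frameD m σ k (frameD m σ k (phase m)))
      = 5 * (∑ i, (frame m σ k).1.1 i * (frame m σ k).1.1 i
        + (frame m σ k).1.2 * (frame m σ k).1.2) - (frame m σ k).2 * (frame m σ k).2 :=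
    fun k => ev_dirD_dirD_phase _ _ hp
  simp only [quadOp, map_sum, map_mul, ev_algebraMap, hh]
  simp only [Fintype.sum_option, waveSign, frame]
  simp
  linear_combination -hσ

theorem quadOp_weight (σ : ℝ) : quadOp (frameD m σ) waveSign (weight m)
    = algebraMap ℝ _ 50 * (weight m * (quadOp (frameD m σ) waveSign (phase m)
      + algebraMap ℝ _ 50 * gradForm (frameD m σ) waveSign (phase m) (phase m))) := by
  simp only [quadOp, gradForm, frameD, dirD_dirD_weight, Finset.mul_sum,
    ← Finset.sum_add_distrib]
  exact Finset.sum_congr rfl fun k _ => by ring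

theorem ev_weightCoeff_slice {σ : ℝ} (hσ : σ ^ 2 = 1) (x : Space m) :
    ev (x, 0) (weightCoeff m σ) = ev (x, 0) (weightCoeff m 1) := by
  have hx : ((x, 0) : SpaceTime m) ∈ halfSpace m := le_refl (0 : ℝ)
  have h1 : (1 : ℝ) ^ 2 = 1 := one_pow 2
  simp only [weightCoeff, quadOp_weight, map_sub, map_mul, map_add, ev_quadOp_phase hσ hx,
    ev_quadOp_phase h1 hx, ev_gradForm_phase hσ hx, ev_gradForm_phase h1 hx, mul_zero]

theorem sliceFlux_congr (τ : ℝ) {w w' θ θ' : smoothAlg m}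
    (hw : ∀ x : Space m, ev (x, 0) w = ev (x, 0) w')
    (hθ : ∀ x : Space m, ev (x, 0) θ = ev (x, 0) θ') (x : Space m) :
    sliceFlux τ w θ x = sliceFlux τ w' θ' x := by
  simp only [sliceFlux, hw, hθ, ev_dirD_slice _ hw, ev_dirD_slice _ hθ]

theorem integral_fluxDiv_add (τ : ℝ) {wp wm : smoothAlg m} (hp : wp ∈ vanishIdeal m)
    (hm : wm ∈ vanishIdeal m) (hw : ∀ x : Space m, ev (x, 0) wp = ev (x, 0) wm) :
    ∫ p, ev p (fluxDiv m 1 τ wp) ∂(halfMeasure m)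
      + ∫ p, ev p (fluxDiv m (-1) τ wm) ∂(halfMeasure m) = 0 := by
  simp only [fluxDiv]
  rw [integral_sum_frameD 1 fun k => bddOn_of_mem_vanishIdeal
      (carlemanFlux_mem_vanishIdeal hp 1 _ _ _ k),
    integral_sum_frameD (-1) fun k => bddOn_of_mem_vanishIdeal
      (carlemanFlux_mem_vanishIdeal hm (-1) _ _ _ k)]
  simp only [boundaryFlux_eq (one_pow 2), boundaryFlux_eq (by norm_num : (-1 : ℝ) ^ 2 = 1)]
  have h : ∀ x, sliceFlux τ wm (weightCoeff m (-1)) x = sliceFlux τ wp (weightCoeff m 1) x :=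
    sliceFlux_congr τ (fun x => (hw x).symm) (ev_weightCoeff_slice (by norm_num))
  simp only [h, integral_neg, integral_const_mul]
  ring

theorem fluxDiv_mem_vanishIdeal {w : smoothAlg m} (hw : w ∈ vanishIdeal m) (σ τ : ℝ) :
    fluxDiv m σ τ w ∈ vanishIdeal m :=
  Ideal.sum_mem _ fun _ _ => dirD_mem_vanishIdeal (carlemanFlux_mem_vanishIdeal hw σ _ _ _ _) _

/-- The weighted energy controlled by the Carleman estimate. -/
noncomputable def energy (m : ℕ) (σ τ : ℝ) (w : smoothAlg m) : ℝ :=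
  ∫ p, (τ * ev p (gradSq (frameD m σ) w) + τ ^ 3 * ev p w ^ 2) ∂(halfMeasure m)

theorem integrable_energy {w : smoothAlg m} (hw : w ∈ vanishIdeal m) (σ τ : ℝ) :
    Integrable (fun p => τ * ev p (gradSq (frameD m σ) w) + τ ^ 3 * ev p w ^ 2)
      (halfMeasure m) := by
  refine ((integrable_of_mem_vanishIdeal (gradSq_mem_vanishIdeal hw σ)).const_mul τ).add
    (Integrable.const_mul ?_ _)
  simpa only [map_pow] using
    integrable_of_mem_vanishIdeal (Ideal.pow_mem_of_mem _ hw 2 two_pos)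

theorem integrable_sq_of_mem_vanishIdeal {f : smoothAlg m} (hf : f ∈ vanishIdeal m) :
    Integrable (fun p => ev p f ^ 2) (halfMeasure m) := by
  simpa only [map_pow] using
    integrable_of_mem_vanishIdeal (Ideal.pow_mem_of_mem _ hf 2 two_pos)

theorem carleman_one_sided (m : ℕ) {σ : ℝ} (hσ : σ ^ 2 = 1) :
    ∃ c τ₀ : ℝ, 0 < c ∧ 1 ≤ τ₀ ∧ ∀ τ, τ₀ ≤ τ → ∀ w ∈ vanishIdeal m,
      ∫ p, ev p (fluxDiv m σ τ w) ∂(halfMeasure m) + c * energy m σ τ w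
        ≤ 2 * ∫ p, ev p (conjOp m σ τ w) ^ 2 ∂(halfMeasure m) := by
  obtain ⟨c, τ₀, hc, hτ₀, h⟩ := carleman_pointwise_uniform m hσ
  refine ⟨c, τ₀, hc, hτ₀, fun τ hτ w hw => ?_⟩
  have i1 := integrable_of_mem_vanishIdeal (fluxDiv_mem_vanishIdeal hw σ τ)
  have i2 := (integrable_energy hw σ τ).const_mul c
  have i3 := (integrable_sq_of_mem_vanishIdeal (conjOp_mem_vanishIdeal hw σ τ)).const_mul 2
  rw [energy, ← integral_const_mul, ← integral_add i1 i2, ← integral_const_mul]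
  refine integral_mono_ae (i1.add i2) i3 ?_
  filter_upwards [ae_halfMeasure] with p hp
  by_cases hpK : p ∈ carlemanRegion m
  · exact h τ hτ w p hpK
  · have hz : ∀ f ∈ vanishIdeal m, ev p f = 0 := fun f hf => hf p (le_of_lt hp) hpK
    rw [hz _ (fluxDiv_mem_vanishIdeal hw σ τ), hz _ hw, hz _ (gradSq_mem_vanishIdeal hw σ),
      hz _ (conjOp_mem_vanishIdeal hw σ τ)]
    simp

theorem energy_nonneg {τ : ℝ} (hτ : 0 ≤ τ) (σ : ℝ) (w : smoothAlg m) : 0 ≤ energy m σ τ w := by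
  refine integral_nonneg fun p => ?_
  have : 0 ≤ ev p (gradSq (frameD m σ) w) := by
    rw [gradSq, map_sum]
    exact Finset.sum_nonneg fun k _ => by rw [map_pow]; positivity
  positivity

theorem carleman_two_sided (m : ℕ) :
    ∃ C τ₀ : ℝ, 0 < C ∧ 1 ≤ τ₀ ∧ ∀ τ, τ₀ ≤ τ → ∀ wp ∈ vanishIdeal m, ∀ wm ∈ vanishIdeal m,
      (∀ x : Space m, ev (x, 0) wp = ev (x, 0) wm) →
      energy m 1 τ wp + energy m (-1) τ wm
        ≤ C * (∫ p, ev p (conjOp m 1 τ wp) ^ 2 ∂(halfMeasure m)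
          + ∫ p, ev p (conjOp m (-1) τ wm) ^ 2 ∂(halfMeasure m)) := by
  obtain ⟨c, τ₀, hc, hτ₀, h⟩ := carleman_one_sided m (one_pow 2)
  obtain ⟨c', τ₀', hc', hτ₀', h'⟩ := carleman_one_sided m (by norm_num : (-1 : ℝ) ^ 2 = 1)
  refine ⟨2 / min c c', max τ₀ τ₀', by positivity, hτ₀.trans (le_max_left _ _), ?_⟩
  intro τ hτ wp hp wm hm hw
  have h1 := h τ ((le_max_left _ _).trans hτ) wp hp
  have h2 := h' τ ((le_max_right _ _).trans hτ) wm hm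
  have h3 := integral_fluxDiv_add τ hp hm hw
  have hτ0 : 0 ≤ τ := by linarith [(le_max_left τ₀ τ₀').trans hτ]
  have h4 := mul_le_mul_of_nonneg_right (min_le_left c c') (energy_nonneg hτ0 1 wp)
  have h5 := mul_le_mul_of_nonneg_right (min_le_right c c') (energy_nonneg hτ0 (-1) wm)
  rw [div_mul_eq_mul_div, le_div_iff₀ (by positivity)]
  linarith

theorem energyFlux_mem_vanishIdeal {w : smoothAlg m} (hw : w ∈ vanishIdeal m) (σ : ℝ)
    (θ : smoothAlg m) (k) : energyFlux (frameD m σ) θ w k ∈ vanishIdeal m := by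
  cases k with
  | none => exact neg_mem (Ideal.mul_mem_left _ _ (gradSq_mem_vanishIdeal hw σ))
  | some i => exact Ideal.mul_mem_left _ _ (dirD_mem_vanishIdeal hw _)

theorem integral_slice_dirD_z_sq_le {σ : ℝ} (hσ : σ ^ 2 = 1) {w : smoothAlg m}
    (hw : w ∈ vanishIdeal m) :
    ∫ x : Space m, ev (x, 0) (dirD ((0, 1), 0) w) ^ 2
      ≤ ∫ p, 2 * ev p (frameD m σ none w) * ev p (quadOp (frameD m σ) waveSign w)
          ∂(halfMeasure m) := by
  have hid := energy_identity (frameD m σ) (fun k l f => frameD_comm σ k l f) 1 w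
  have hflux := integral_sum_frameD σ fun k =>
    bddOn_of_mem_vanishIdeal (energyFlux_mem_vanishIdeal hw σ 1 k)
  have h1 : ∀ k, frameD m σ k (1 : smoothAlg m) = 0 := fun k => Derivation.map_one_eq_zero _
  simp only [h1, zero_mul, Finset.sum_const_zero, mul_zero, add_zero, sub_zero, mul_one] at hid
  rw [hid] at hflux
  simp only [map_mul, map_ofNat] at hflux
  rw [hflux, ← integral_neg]
  refine integral_mono ?_ ?_ fun x => ?_
  · simpa only [map_pow] using integrable_slice_of_mem_vanishIdeal
      (Ideal.pow_mem_of_mem _ (dirD_mem_vanishIdeal hw ((0, 1), 0)) 2 two_pos)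
  · exact ((integrable_slice_of_mem_vanishIdeal (energyFlux_mem_vanishIdeal hw σ 1 _)).sub
      ((integrable_slice_of_mem_vanishIdeal
        (energyFlux_mem_vanishIdeal hw σ 1 _)).const_mul _)).neg
  · have hZ : ev (x, 0) (dirD ((0, 1), 0) w)
        = ev (x, 0) (frameD m σ (some none) w) + σ * ev (x, 0) (frameD m σ none w) := by
      rw [dirD_z_eq σ, map_add, map_smul, smul_eq_mul]
    have hs : 0 ≤ ∑ i : Fin m, ev (x, 0) (frameD m σ (some (some i)) w) ^ 2 :=
      Finset.sum_nonneg fun i _ => sq_nonneg _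
    simp only [hZ, energyFlux, map_neg, map_mul, map_one, map_ofNat, ev_gradSq]
    set b := ev (x, 0) (frameD m σ none w)
    have h2 : (σ * b) ^ 2 = b ^ 2 := by rw [mul_pow, hσ, one_mul]
    nlinarith

theorem integral_slice_sq {w : smoothAlg m} (hw : w ∈ vanishIdeal m) (σ : ℝ) :
    ∫ x : Space m, ev (x, 0) w ^ 2
      = ∫ p, -(2 * ev p w * ev p (frameD m σ none w)) ∂(halfMeasure m) := by
  have h := integral_dirD isOpen_univ
    (bddOn_of_mem_vanishIdeal (Ideal.pow_mem_of_mem _ hw 2 two_pos))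
    (fun p _ hp => by simp at hp) (frame m σ none)
  rw [indicator_univ, indicator_univ] at h
  have h1 : ∀ p, (dirD (frame m σ none) (w ^ 2)).1 p = 2 * ev p w * ev p (frameD m σ none w) := by
    intro p
    rw [← ev_apply, ← frameD, Derivation.leibniz_pow]
    simp only [Nat.add_one_sub_one, pow_one, smul_eq_mul, nsmul_eq_mul, map_mul, map_natCast]
    push_cast
    ring
  have h2 : ∀ x : Space m, (w ^ 2).1 (x, 0) = ev (x, 0) w ^ 2 := fun x => rfl
  simp only [h1, h2] at h
  simp only [frame, one_mul] at h
  rw [integral_neg, h, neg_neg]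

theorem gradForm_sq_le (σ : ℝ) (f g : smoothAlg m) (p : SpaceTime m) :
    ev p (gradForm (frameD m σ) waveSign f g) ^ 2
      ≤ ev p (gradSq (frameD m σ) f) * ev p (gradSq (frameD m σ) g) := by
  have h := Finset.sum_mul_sq_le_sq_mul_sq Finset.univ
    (fun k => waveSign k * ev p (frameD m σ k f)) (fun k => ev p (frameD m σ k g))
  have hs : ∀ k : Option (Option (Fin m)), waveSign k ^ 2 = 1 := by
    rintro (_ | k) <;> simp [waveSign]
  simp only [mul_pow, hs, one_mul] at h
  simpa only [gradForm, gradSq, map_sum, map_mul, map_pow, ev_algebraMap, mul_assoc] using h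

theorem frameD_sq_le_gradSq (σ : ℝ) (k) (f : smoothAlg m) (p : SpaceTime m) :
    ev p (frameD m σ k f) ^ 2 ≤ ev p (gradSq (frameD m σ) f) := by
  simp only [gradSq, map_sum, map_pow]
  exact Finset.single_le_sum (f := fun k => ev p (frameD m σ k f) ^ 2)
    (fun k _ => sq_nonneg _) (Finset.mem_univ k)

theorem trace_pointwise (m : ℕ) (σ : ℝ) :
    ∃ C : ℝ, 0 < C ∧ ∀ τ, 1 ≤ τ → ∀ (w : smoothAlg m), ∀ p ∈ carlemanRegion m,
      2 * ev p (frameD m σ none w) * ev p (quadOp (frameD m σ) waveSign w)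
        ≤ ev p (conjOp m σ τ w) ^ 2
          + C * (τ * ev p (gradSq (frameD m σ) w) + τ ^ 3 * ev p w ^ 2) := by
  obtain ⟨a, ha, hwa⟩ := exists_bound_carlemanRegion
    (gradForm (frameD m σ) waveSign (weight m) (weight m))
  obtain ⟨b, hb, hwb⟩ := exists_bound_carlemanRegion (gradSq (frameD m σ) (weight m))
  obtain ⟨c, hc, hwc⟩ := exists_bound_carlemanRegion (quadOp (frameD m σ) waveSign (weight m))
  refine ⟨5 + 2 * b + a ^ 2 + c ^ 2, by positivity, ?_⟩
  intro τ hτ w p hp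
  have hM := gradForm_sq_le σ (weight m) w p
  have ht := frameD_sq_le_gradSq σ none w p
  have hF : ev p (quadOp (frameD m σ) waveSign w) = ev p (conjOp m σ τ w)
      - τ ^ 2 * ev p (gradForm (frameD m σ) waveSign (weight m) (weight m)) * ev p w
      + 2 * τ * ev p (gradForm (frameD m σ) waveSign (weight m) w)
      + τ * ev p (quadOp (frameD m σ) waveSign (weight m)) * ev p w := by
    simp only [conjOp, map_sub, map_add, map_mul, map_pow, map_ofNat, ev_algebraMap]
    ring
  have hA := sq_le_sq' (neg_le_of_abs_le (hwa p hp)) (le_of_abs_le (hwa p hp))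
  have hB := le_of_abs_le (hwb p hp)
  have hC := sq_le_sq' (neg_le_of_abs_le (hwc p hp)) (le_of_abs_le (hwc p hp))
  rw [hF]
  set F := ev p (conjOp m σ τ w)
  set G := ev p (gradForm (frameD m σ) waveSign (weight m) (weight m))
  set M := ev p (gradForm (frameD m σ) waveSign (weight m) w)
  set L := ev p (quadOp (frameD m σ) waveSign (weight m))
  set B := ev p (gradSq (frameD m σ) (weight m))
  set g := ev p (gradSq (frameD m σ) w)
  set W := ev p w
  set d := ev p (frameD m σ none w)
  have hτ0 : 0 < τ := by linarith
  have hg : 0 ≤ g := (sq_nonneg d).trans ht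
  have hMb : M ^ 2 ≤ b * g := hM.trans (mul_le_mul_of_nonneg_right hB hg)
  have k1 : 2 * d * F ≤ F ^ 2 + τ * g := by nlinarith [sq_nonneg (d - F)]
  have k2 : -(2 * d * (τ ^ 2 * G * W)) ≤ τ * g + a ^ 2 * (τ ^ 3 * W ^ 2) := by
    have : 0 ≤ τ * (d + τ * G * W) ^ 2 := by positivity
    have h3 : τ ^ 3 * W ^ 2 * G ^ 2 ≤ τ ^ 3 * W ^ 2 * a ^ 2 := by gcongr
    nlinarith
  have k3 : 2 * d * (2 * τ * M) ≤ (2 + 2 * b) * (τ * g) := by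
    have : 0 ≤ τ * (d - M) ^ 2 := by positivity
    have h3 : τ * M ^ 2 ≤ τ * (b * g) := by gcongr
    nlinarith
  have k4 : 2 * d * (τ * L * W) ≤ τ * g + c ^ 2 * (τ ^ 3 * W ^ 2) := by
    have : 0 ≤ τ * (d - L * W) ^ 2 := by positivity
    have h4 : τ ≤ τ ^ 3 := by nlinarith [sq_nonneg (τ - 1)]
    have h3 : τ * W ^ 2 * L ^ 2 ≤ τ ^ 3 * W ^ 2 * c ^ 2 := by gcongr
    nlinarith
  have k5 : 0 ≤ (a ^ 2 + c ^ 2) * (τ * g) := by positivity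
  have k6 : 0 ≤ (5 + 2 * b) * (τ ^ 3 * W ^ 2) := by positivity
  nlinarith

theorem trace_estimate (m : ℕ) {σ : ℝ} (hσ : σ ^ 2 = 1) :
    ∃ C : ℝ, 0 < C ∧ ∀ τ, 1 ≤ τ → ∀ w ∈ vanishIdeal m,
      (∫ x : Space m, ev (x, 0) (dirD ((0, 1), 0) w) ^ 2)
          + τ ^ 2 * ∫ x : Space m, ev (x, 0) w ^ 2
        ≤ ∫ p, ev p (conjOp m σ τ w) ^ 2 ∂(halfMeasure m) + C * energy m σ τ w := by
  obtain ⟨C, hC, h⟩ := trace_pointwise m σ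
  refine ⟨C + 1, by positivity, fun τ hτ w hw => ?_⟩
  have h1 := integral_slice_dirD_z_sq_le hσ hw
  have hdt : frameD m σ none w ∈ vanishIdeal m := dirD_mem_vanishIdeal hw _
  have i0 := integrable_energy hw σ τ
  have i1 := integrable_sq_of_mem_vanishIdeal (conjOp_mem_vanishIdeal hw σ τ)
  have hzero : ∀ p, 0 < p.2 → p ∉ carlemanRegion m → ∀ f ∈ vanishIdeal m, ev p f = 0 :=
    fun p hp hpK f hf => hf p (le_of_lt hp) hpK
  have i2 : Integrable (fun p => 2 * ev p (frameD m σ none w)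
      * ev p (quadOp (frameD m σ) waveSign w)) (halfMeasure m) := by
    simpa only [map_mul, map_ofNat] using integrable_of_mem_vanishIdeal
      (Ideal.mul_mem_left _ (2 * frameD m σ none w) (quadOp_mem_vanishIdeal hw σ))
  have i3 : Integrable (fun p => τ ^ 2 * -(2 * ev p w * ev p (frameD m σ none w)))
      (halfMeasure m) := by
    have := integrable_of_mem_vanishIdeal (Ideal.mul_mem_left _ (2 * w) hdt)
    simp only [map_mul, map_ofNat] at this
    exact this.neg.const_mul _
  have h2 : ∫ p, 2 * ev p (frameD m σ none w) * ev p (quadOp (frameD m σ) waveSign w)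
          ∂(halfMeasure m)
      ≤ ∫ p, ev p (conjOp m σ τ w) ^ 2 ∂(halfMeasure m) + C * energy m σ τ w := by
    rw [energy, ← integral_const_mul, ← integral_add i1 (i0.const_mul C)]
    refine integral_mono_ae i2 (i1.add (i0.const_mul C)) ?_
    filter_upwards [ae_halfMeasure] with p hp
    by_cases hpK : p ∈ carlemanRegion m
    · exact h τ hτ w p hpK
    · have hz := hzero p hp hpK
      rw [hz _ hdt, hz _ hw, hz _ (gradSq_mem_vanishIdeal hw σ),
        hz _ (conjOp_mem_vanishIdeal hw σ τ)]
      simp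
  have h3 : τ ^ 2 * ∫ x : Space m, ev (x, 0) w ^ 2 ≤ energy m σ τ w := by
    rw [integral_slice_sq hw σ, ← integral_const_mul, energy]
    refine integral_mono i3 i0 fun p => ?_
    have ht := frameD_sq_le_gradSq σ none w p
    have k1 : 0 ≤ τ * (ev p (frameD m σ none w) + τ * ev p w) ^ 2 := by positivity
    have k2 := mul_le_mul_of_nonneg_left ht (by linarith : 0 ≤ τ)
    dsimp only
    nlinarith
  linarith

/-- The exponential Carleman weight `exp (τ φ)`. -/
noncomputable def expWeight (m : ℕ) (τ : ℝ) : smoothAlg m :=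
  expElt (algebraMap ℝ _ τ * weight m)

theorem ev_expWeight (τ : ℝ) (p : SpaceTime m) :
    ev p (expWeight m τ) = Real.exp (τ * ev p (weight m)) := by
  rw [expWeight, ev_expElt, map_mul, ev_algebraMap]

theorem dirD_expWeight (τ : ℝ) (e : SpaceTime m) :
    dirD e (expWeight m τ) = algebraMap ℝ _ τ * expWeight m τ * dirD e (weight m) := by
  rw [expWeight, dirD_expElt, Derivation.leibniz, Derivation.map_algebraMap, smul_zero, add_zero,
    smul_eq_mul]
  ring

theorem expWeight_mul_quadOp (σ τ : ℝ) (V : smoothAlg m) :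
    expWeight m τ * quadOp (frameD m σ) waveSign V = conjOp m σ τ (expWeight m τ * V) :=
  quadOp_conjugate (frameD m σ) waveSign τ (algebraMap ℝ _ τ) (weight m) (expWeight m τ) V rfl
    fun _ => dirD_expWeight τ _

theorem integral_slice_expWeight_dirD_z_le (m : ℕ) :
    ∃ C : ℝ, 0 < C ∧ ∀ τ, 1 ≤ τ → ∀ V ∈ vanishIdeal m,
      ∫ x : Space m, ev (x, 0) (expWeight m τ * dirD ((0, 1), 0) V) ^ 2
        ≤ C * ((∫ x : Space m, ev (x, 0) (dirD ((0, 1), 0) (expWeight m τ * V)) ^ 2)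
          + τ ^ 2 * ∫ x : Space m, ev (x, 0) (expWeight m τ * V) ^ 2) := by
  obtain ⟨a, ha, hwa⟩ := exists_bound_carlemanRegion (dirD ((0, 1), 0) (weight m))
  refine ⟨2 + 2 * a ^ 2, by positivity, fun τ hτ V hV => ?_⟩
  set w := expWeight m τ * V with hw
  have hwm : w ∈ vanishIdeal m := Ideal.mul_mem_left _ _ hV
  have key : expWeight m τ * dirD ((0, 1), 0) V
      = dirD ((0, 1), 0) w - algebraMap ℝ _ τ * dirD ((0, 1), 0) (weight m) * w := by
    rw [hw, Derivation.leibniz, dirD_expWeight, smul_eq_mul, smul_eq_mul]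
    ring
  have hsl : ∀ f ∈ vanishIdeal m, Integrable fun x : Space m => ev (x, 0) f ^ 2 := fun f hf => by
    simpa only [map_pow] using
      integrable_slice_of_mem_vanishIdeal (Ideal.pow_mem_of_mem _ hf 2 two_pos)
  have i1 := hsl _ (dirD_mem_vanishIdeal hwm ((0, 1), 0))
  have i2 := (hsl _ hwm).const_mul (τ ^ 2)
  rw [← integral_const_mul, ← integral_add i1 i2, ← integral_const_mul]
  refine integral_mono (hsl _ (Ideal.mul_mem_left _ _ (dirD_mem_vanishIdeal hV _)))
    ((i1.add i2).const_mul _) fun x => ?_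
  simp only [key, map_sub, map_mul, ev_algebraMap]
  have hb : ev (x, 0) (dirD ((0, 1), 0) (weight m)) ^ 2 * ev (x, 0) w ^ 2
      ≤ a ^ 2 * ev (x, 0) w ^ 2 := by
    by_cases hx : ((x, 0) : SpaceTime m) ∈ carlemanRegion m
    · have := hwa _ hx
      rw [← sq_abs (ev (x, 0) (dirD ((0, 1), 0) (weight m)))]
      gcongr
    · rw [hwm (x, 0) (le_refl (0 : ℝ)) hx]; simp
  set W := ev (x, 0) w
  set d := ev (x, 0) (dirD ((0, 1), 0) w)
  set f := ev (x, 0) (dirD ((0, 1), 0) (weight m))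
  have h1 := mul_le_mul_of_nonneg_left hb (sq_nonneg τ)
  have h2 : 0 ≤ a ^ 2 * d ^ 2 := by positivity
  have h3 : 0 ≤ τ ^ 2 * W ^ 2 := by positivity
  nlinarith [sq_nonneg (d + τ * f * W)]

/-- The Carleman estimate, with control of the trace on `s = 0`, for a pair of functions agreeing
on `s = 0`. -/
theorem carleman_estimate (m : ℕ) :
    ∃ C τ₀ : ℝ, 0 < C ∧ 1 ≤ τ₀ ∧ ∀ τ, τ₀ ≤ τ → ∀ Vp ∈ vanishIdeal m, ∀ Vm ∈ vanishIdeal m,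
      (∀ x : Space m, ev (x, 0) Vp = ev (x, 0) Vm) →
      (∫ x : Space m, ev (x, 0) (expWeight m τ * dirD ((0, 1), 0) Vp) ^ 2)
          + τ ^ 3 * ((∫ p, ev p (expWeight m τ * Vp) ^ 2 ∂(halfMeasure m))
            + ∫ p, ev p (expWeight m τ * Vm) ^ 2 ∂(halfMeasure m))
        ≤ C * ((∫ p, ev p (expWeight m τ * quadOp (frameD m 1) waveSign Vp) ^ 2 ∂(halfMeasure m))
          + ∫ p, ev p (expWeight m τ * quadOp (frameD m (-1)) waveSign Vm) ^ 2
            ∂(halfMeasure m)) := by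
  obtain ⟨a, ha, h1⟩ := integral_slice_expWeight_dirD_z_le m
  obtain ⟨b, hb, h2⟩ := trace_estimate m (one_pow 2)
  obtain ⟨c, τ₀, hc, hτ₀, h3⟩ := carleman_two_sided m
  refine ⟨a + (a * b + 1) * c, τ₀, by positivity, hτ₀, fun τ hτ Vp hVp Vm hVm hV => ?_⟩
  have hτ1 : 1 ≤ τ := hτ₀.trans hτ
  have hwp : expWeight m τ * Vp ∈ vanishIdeal m := Ideal.mul_mem_left _ _ hVp
  have hwm : expWeight m τ * Vm ∈ vanishIdeal m := Ideal.mul_mem_left _ _ hVm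
  have h1 := h1 τ hτ1 Vp hVp
  have h2 := h2 τ hτ1 _ hwp
  have h3 := h3 τ hτ _ hwp _ hwm fun x => by rw [map_mul, map_mul, hV x]
  have he : ∀ (σ : ℝ) (w : smoothAlg m), w ∈ vanishIdeal m →
      τ ^ 3 * ∫ p, ev p w ^ 2 ∂(halfMeasure m) ≤ energy m σ τ w := by
    intro σ w hw
    rw [← integral_const_mul, energy]
    refine integral_mono ((integrable_sq_of_mem_vanishIdeal hw).const_mul _)
      (integrable_energy hw σ τ) fun p => ?_
    have := (sq_nonneg _).trans (frameD_sq_le_gradSq σ none w p)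
    dsimp only
    nlinarith
  have h4 := he 1 _ hwp
  have h5 := he (-1) _ hwm
  have h6 := energy_nonneg (by linarith : 0 ≤ τ) (-1) (expWeight m τ * Vm)
  rw [expWeight_mul_quadOp, expWeight_mul_quadOp]
  have hG : 0 ≤ ∫ p, ev p (conjOp m (-1) τ (expWeight m τ * Vm)) ^ 2 ∂(halfMeasure m) :=
    integral_nonneg fun p => sq_nonneg _
  set X := ∫ p, ev p (conjOp m 1 τ (expWeight m τ * Vp)) ^ 2 ∂(halfMeasure m)
  set Y := ∫ p, ev p (conjOp m (-1) τ (expWeight m τ * Vm)) ^ 2 ∂(halfMeasure m)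
  set e₁ := energy m 1 τ (expWeight m τ * Vp)
  set e₂ := energy m (-1) τ (expWeight m τ * Vm)
  have h7 := mul_le_mul_of_nonneg_left h2 ha.le
  have h8 := mul_le_mul_of_nonneg_left h3 (by positivity : 0 ≤ a * b + 1)
  have h9 : 0 ≤ a * b * e₂ := by positivity
  have h10 : 0 ≤ a * Y := by positivity
  linarith

/-- A derivative in a direction not leaving the half space vanishes if the function vanishes along
the corresponding ray near its endpoint. -/
theorem ev_dirD_eq_zero_of_ray {f : smoothAlg m} {p e : SpaceTime m} (hp : p ∈ halfSpace m)
    (he : 0 ≤ e.2) (h : ∀ᶠ r in 𝓝[≥] (0 : ℝ), ev (p + r • e) f = 0) : ev p (dirD e f) = 0 := by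
  have hI : MapsTo (fun r : ℝ => p + r • e) (Ici 0) (halfSpace m) := fun r hr =>
    add_nonneg (a := p.2) hp (mul_nonneg hr he)
  have h1 := hasDerivWithinAt_line f p e hI (hI self_mem_Ici)
  have h2 : HasDerivWithinAt (fun r : ℝ => f.1 (p + r • e)) 0 (Ici 0) 0 :=
    (hasDerivWithinAt_const (0 : ℝ) (Ici 0) (0 : ℝ)).congr_of_eventuallyEq h
      (h.self_of_nhdsWithin self_mem_Ici)
  have h3 := (uniqueDiffWithinAt_Ici (0 : ℝ)).eq_deriv _ h1 h2
  rw [zero_smul, add_zero] at h3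
  exact h3

/-- The function `t = s + σ z`. -/
noncomputable def timeElt (m : ℕ) (σ : ℝ) : smoothAlg m := coordS + algebraMap ℝ _ σ * coordZ

@[simp] theorem ev_timeElt (σ : ℝ) (p : SpaceTime m) : ev p (timeElt m σ) = p.2 + σ * p.1.2 := by
  simp [timeElt]

/-- The function `(T - t) ((R - t)² - |x|²)`. -/
noncomputable def coneElt (m : ℕ) (σ T R : ℝ) : smoothAlg m :=
  (algebraMap ℝ _ T - timeElt m σ)
    * ((algebraMap ℝ _ R - timeElt m σ) ^ 2 - (∑ i, coordY i ^ 2 + coordZ ^ 2))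

theorem ev_coneElt (σ T R : ℝ) (p : SpaceTime m) : ev p (coneElt m σ T R)
    = (T - (p.2 + σ * p.1.2)) * ((R - (p.2 + σ * p.1.2)) ^ 2 - normSq p.1) := by
  simp [coneElt, normSq]

theorem ev_dirD_coneElt (σ T R : ℝ) (e : SpaceTime m) {p : SpaceTime m} (hp : p ∈ halfSpace m) :
    ev p (dirD e (coneElt m σ T R))
      = -(e.2 + σ * e.1.2) * ((R - (p.2 + σ * p.1.2)) ^ 2 - normSq p.1)
        - (T - (p.2 + σ * p.1.2)) * (2 * (R - (p.2 + σ * p.1.2)) * (e.2 + σ * e.1.2)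
          + 2 * (∑ i, p.1.1 i * e.1.1 i + p.1.2 * e.1.2)) := by
  have h1 : ∀ i : Fin m, ev p (dirD e (coordY i)) = e.1.1 i := fun i => ev_dirD_linElt _ e hp
  have h2 : ev p (dirD e coordZ) = e.1.2 := ev_dirD_linElt _ e hp
  have h3 : ev p (dirD e coordS) = e.2 := ev_dirD_linElt _ e hp
  have h4 : ev p (dirD e (timeElt m σ)) = e.2 + σ * e.1.2 := by
    simp [timeElt, h2, h3, Derivation.leibniz]
  simp only [coneElt, Derivation.leibniz, Derivation.leibniz_pow, map_sub, map_add, map_sum,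
    Derivation.map_algebraMap, smul_eq_mul, nsmul_eq_mul, map_mul, map_pow, h1, h2, h4,
    ev_algebraMap, ev_timeElt, ev_coordY, ev_coordZ, map_natCast, map_zero, normSq]
  have h5 : ∑ i : Fin m, ((2 : ℕ) : ℝ) * (p.1.1 i ^ (2 - 1) * e.1.1 i)
      = 2 * ∑ i, p.1.1 i * e.1.1 i := by
    rw [Finset.mul_sum]; simp
  rw [h5]
  push_cast
  ring

theorem ev_coneElt_energy_ge {σ T R : ℝ} (v : smoothAlg m) {p : SpaceTime m}
    (hp : p ∈ halfSpace m) (hT : p.2 + σ * p.1.2 < T) (hTR : T < R)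
    (hx : normSq p.1 < (R - (p.2 + σ * p.1.2)) ^ 2) :
    ((R - (p.2 + σ * p.1.2)) ^ 2 - normSq p.1) * ev p (gradSq (frameD m σ) v)
      ≤ ev p (2 * frameD m σ none v
          * ∑ i, frameD m σ (some i) (coneElt m σ T R) * frameD m σ (some i) v
        - frameD m σ none (coneElt m σ T R) * gradSq (frameD m σ) v) := by
  set t := p.2 + σ * p.1.2 with ht
  let X : Option (Fin m) → ℝ
    | none => p.1.2
    | some i => p.1.1 i
  have hXs : ∑ i, X i ^ 2 = normSq p.1 := by
    simp only [Fintype.sum_option, normSq, X]; ring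
  have hθt : ev p (frameD m σ none (coneElt m σ T R))
      = -((R - t) ^ 2 - normSq p.1) - 2 * (T - t) * (R - t) := by
    rw [frameD, ev_dirD_coneElt _ _ _ _ hp]
    simp [frame]
    ring
  have hθx : ∀ i, ev p (frameD m σ (some i) (coneElt m σ T R)) = -(2 * (T - t)) * X i := by
    intro i
    rw [frameD, ev_dirD_coneElt _ _ _ _ hp]
    rcases i with _ | i
    · simp [frame, X]; ring
    · simp [frame, X]; ring
  have hg : ev p (gradSq (frameD m σ) v) = ev p (frameD m σ none v) ^ 2
      + ∑ i, ev p (frameD m σ (some i) v) ^ 2 := by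
    rw [ev_gradSq]
    simp only [Fintype.sum_option]
    ring
  simp only [map_sub, map_mul, map_ofNat, map_sum, hθt, hθx, hg]
  have hM := Finset.sum_mul_sq_le_sq_mul_sq Finset.univ X fun i => ev p (frameD m σ (some i) v)
  have hsum : ∑ i, -(2 * (T - t)) * X i * ev p (frameD m σ (some i) v)
      = -(2 * (T - t)) * ∑ i, X i * ev p (frameD m σ (some i) v) := by
    rw [Finset.mul_sum]; simp only [mul_assoc]
  rw [hXs] at hM
  rw [hsum]
  have hS : 0 ≤ ∑ i, ev p (frameD m σ (some i) v) ^ 2 := Finset.sum_nonneg fun i _ => sq_nonneg _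
  set S := ∑ i, ev p (frameD m σ (some i) v) ^ 2
  set M := ∑ i, X i * ev p (frameD m σ (some i) v)
  set d := ev p (frameD m σ none v)
  set r := R - t with hr
  have hr0 : 0 < r := by linarith
  have hMr : M ^ 2 ≤ r ^ 2 * S := hM.trans (mul_le_mul_of_nonneg_right hx.le hS)
  have k : 0 ≤ r * (d ^ 2 + S) - 2 * d * M := by
    refine (mul_nonneg_iff_of_pos_left hr0).1 ?_
    nlinarith [sq_nonneg (r * d - M)]
  have k2 := mul_nonneg (by linarith : 0 ≤ 2 * (T - t)) k
  nlinarith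

/-- The truncated cone outside the unit ball on which the energy identity is used. -/
def coneRegion (m : ℕ) (σ T R : ℝ) : Set (SpaceTime m) :=
  {p | 1 < normSq p.1 ∧ p.2 + σ * p.1.2 < T ∧ normSq p.1 < (R - (p.2 + σ * p.1.2)) ^ 2}

theorem continuous_normSq_fst : Continuous fun p : SpaceTime m => normSq p.1 :=
  continuous_normSq.comp continuous_fst

theorem continuous_time (σ : ℝ) : Continuous fun p : SpaceTime m => p.2 + σ * p.1.2 := by
  fun_prop

theorem isOpen_coneRegion (m : ℕ) (σ T R : ℝ) : IsOpen (coneRegion m σ T R) :=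
  (isOpen_lt continuous_const continuous_normSq_fst).inter
    ((isOpen_lt (continuous_time σ) continuous_const).inter
      (isOpen_lt continuous_normSq_fst ((continuous_const.sub (continuous_time σ)).pow 2)))

theorem closure_coneRegion_subset (m : ℕ) (σ T R : ℝ) : closure (coneRegion m σ T R) ⊆
    {p | 1 ≤ normSq p.1 ∧ p.2 + σ * p.1.2 ≤ T ∧ normSq p.1 ≤ (R - (p.2 + σ * p.1.2)) ^ 2} :=
  closure_minimal (fun _ hp => ⟨hp.1.le, hp.2.1.le, hp.2.2.le⟩)
    ((isClosed_le continuous_const continuous_normSq_fst).inter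
      ((isClosed_le (continuous_time σ) continuous_const).inter
        (isClosed_le continuous_normSq_fst ((continuous_const.sub (continuous_time σ)).pow 2))))

/-- On the boundary of the cone, either `|x| = 1` or the cone function vanishes. -/
theorem ev_coneElt_of_mem_frontier {σ T R : ℝ} {p : SpaceTime m}
    (hp : p ∈ frontier (coneRegion m σ T R)) :
    (normSq p.1 = 1 ∧ p.2 + σ * p.1.2 < T) ∨ ev p (coneElt m σ T R) = 0 := by
  obtain ⟨h1, h2, h3⟩ := closure_coneRegion_subset m σ T R (frontier_subset_closure hp)
  have hnot : p ∉ coneRegion m σ T R := by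
    rw [(isOpen_coneRegion m σ T R).frontier_eq] at hp
    exact hp.2
  rw [ev_coneElt]
  rcases h2.eq_or_lt with h2 | h2
  · right; rw [h2, sub_self, zero_mul]
  rcases h1.eq_or_lt with h1 | h1
  · exact Or.inl ⟨h1.symm, h2⟩
  rcases h3.eq_or_lt with h3 | h3
  · right; rw [h3, sub_self, mul_zero]
  · exact absurd ⟨h1, h2, h3⟩ hnot

theorem ev_coneElt_of_line_frontier {σ T R : ℝ} {p : SpaceTime m}
    (hp : (0 : ℝ) ∈ frontier {r : ℝ | p + r • ((0 : Space m), (1 : ℝ)) ∈ coneRegion m σ T R}) :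
    ev p (coneElt m σ T R) = 0 := by
  have hc : Continuous fun r : ℝ => p + r • ((0 : Space m), (1 : ℝ)) := by fun_prop
  have hfr : p ∈ frontier (coneRegion m σ T R) := by
    have := hc.frontier_preimage_subset _ hp
    rwa [mem_preimage, zero_smul, add_zero] at this
  refine (ev_coneElt_of_mem_frontier hfr).resolve_left fun h => ?_
  have hempty : {r : ℝ | p + r • ((0 : Space m), (1 : ℝ)) ∈ coneRegion m σ T R} = ∅ := by
    refine eq_empty_of_forall_notMem fun r hr => ?_
    have := hr.1
    simp [h.1] at this
  rw [hempty, frontier_empty] at hp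
  exact hp

theorem abs_eq_one_of_sq {σ : ℝ} (hσ : σ ^ 2 = 1) : |σ| = 1 := by
  rcases sq_eq_one_iff.1 hσ with rfl | rfl <;> simp

theorem norm_le_of_mem_coneRegion {σ T R : ℝ} (hσ : σ ^ 2 = 1) (hT : 0 < T) (hTR : T < R)
    {p : SpaceTime m} (hp : p ∈ halfSpace m) (hpΩ : p ∈ coneRegion m σ T R)
    (ht : -1 ≤ p.2 + σ * p.1.2) : ‖p‖ ≤ T + R + 1 := by
  obtain ⟨-, h2, h3⟩ := hpΩ
  have hx : normSq p.1 ≤ (R + 1) ^ 2 := h3.le.trans (by gcongr <;> linarith)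
  have h4 : ‖p.1‖ ≤ R + 1 := norm_le_of_normSq_le (by linarith) hx
  have h5 : |p.1.2| ≤ R + 1 := (norm_snd_le p.1).trans h4
  have h6 : |σ * p.1.2| ≤ R + 1 := by
    rw [abs_mul, abs_eq_one_of_sq hσ, one_mul]; exact h5
  rw [Prod.norm_def]
  refine max_le (by linarith) ?_
  rw [Real.norm_eq_abs, abs_of_nonneg hp]
  linarith [neg_abs_le (σ * p.1.2)]

theorem bddOn_energyFlux {σ T R : ℝ} (hσ : σ ^ 2 = 1) (hT : 0 < T) (hTR : T < R) {v : smoothAlg m}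
    (hic : ∀ p ∈ halfSpace m, p.2 + σ * p.1.2 < -1 → ev p v = 0) (k) :
    BddOn (coneRegion m σ T R) (T + R + 1)
      (energyFlux (frameD m σ) (coneElt m σ T R) v k) := by
  intro p hp hpΩ hpR
  have ht : p.2 + σ * p.1.2 < -1 := by
    by_contra! ht
    exact (norm_le_of_mem_coneRegion hσ hT hTR hp hpΩ ht).not_gt hpR
  have hd : ∀ l, ev p (frameD m σ l v) = 0 := fun l => by
    have := ev_dirD_congr (frame m σ l) (f := v) (g := 0)
      (U := {p | p.2 + σ * p.1.2 < -1}) (isOpen_lt (by fun_prop) continuous_const)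
      (fun p hp' hp => by rw [hic p hp hp', map_zero]) p ht hp
    rw [map_zero, map_zero] at this
    exact this
  rw [← ev_apply]
  cases k with
  | none => simp only [energyFlux, gradSq, map_neg, map_mul, map_sum, map_pow, hd]; simp
  | some i => simp only [energyFlux, map_mul, hd, mul_zero]

theorem integral_energyFlux_eq {σ T R : ℝ} (hσ : σ ^ 2 = 1) (hT : 0 < T) (hTR : T < R)
    {v : smoothAlg m}
    (h0 : ∀ x : Space m, 1 < normSq x → ev (x, 0) v = 0)
    (hic : ∀ p ∈ halfSpace m, p.2 + σ * p.1.2 < -1 → ev p v = 0)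
    (hdata : ∀ p ∈ halfSpace m, normSq p.1 = 1 → p.2 + σ * p.1.2 ≤ T → ev p v = 0) :
    ∫ p, (coneRegion m σ T R).indicator
      (∑ k, frameD m σ k (energyFlux (frameD m σ) (coneElt m σ T R) v k)).1 p ∂(halfMeasure m)
      = 0 := by
  set Ω := coneRegion m σ T R
  set P := energyFlux (frameD m σ) (coneElt m σ T R) v
  have hΩ : IsOpen Ω := isOpen_coneRegion m σ T R
  have hB : ∀ k, BddOn Ω (T + R + 1) (P k) := bddOn_energyFlux hσ hT hTR hic
  have hsum : ∀ p, Ω.indicator (∑ k, frameD m σ k (P k)).1 p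
      = ∑ k, Ω.indicator (frameD m σ k (P k)).1 p := by
    intro p
    by_cases hp : p ∈ Ω
    · simp only [indicator_of_mem hp, ← ev_apply, map_sum]
    · simp only [indicator_of_notMem hp, Finset.sum_const_zero]
  have hnone : ∫ p, Ω.indicator (frameD m σ none (P none)).1 p ∂(halfMeasure m)
      = -∫ x : Space m, Ω.indicator (P none).1 (x, 0) := by
    refine integral_dirD_normal hΩ (hB none) fun p hp hfr => ?_
    rw [← ev_apply]
    simp only [P, energyFlux, map_neg, map_mul, ev_coneElt_of_line_frontier hfr, zero_mul, neg_zero]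
  have hsome : ∀ i, ∫ p, Ω.indicator (frameD m σ (some i) (P (some i))).1 p ∂(halfMeasure m)
      = -((frame m σ (some i)).2 * ∫ x : Space m, Ω.indicator (P (some i)).1 (x, 0)) := by
    intro i
    refine integral_dirD hΩ (hB (some i)) (fun p hp hfr => ?_) _
    rw [← ev_apply]
    simp only [P, energyFlux, map_mul]
    rcases ev_coneElt_of_mem_frontier hfr with h | h
    · have hv : ev p (frameD m σ none v) = 0 := by
        refine ev_dirD_eq_zero_of_ray hp (by simp [frame]) ?_
        have hc : Continuous fun r : ℝ => (p + r • frame m σ none).2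
            + σ * (p + r • frame m σ none).1.2 := by fun_prop
        have hev : ∀ᶠ r in 𝓝 (0 : ℝ), (p + r • frame m σ none).2
            + σ * (p + r • frame m σ none).1.2 < T :=
          hc.continuousAt.eventually_lt continuousAt_const (by simpa using h.2)
        filter_upwards [nhdsWithin_le_nhds hev, self_mem_nhdsWithin] with r hr hr0
        refine hdata _ ?_ ?_ hr.le
        · exact add_nonneg (a := p.2) hp (by simpa [frame] using hr0)
        · simpa [frame] using h.1
      simp [hv]
    · simp [h]
  simp only [hsum]
  have hI : ∀ k, Integrable (Ω.indicator (frameD m σ k (P k)).1) (halfMeasure m) := fun k =>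
    integrable_indicator_of_bddOn hΩ ((hB k).dirD hΩ _)
  rw [integral_finsetSum _ fun k _ => hI k]
  simp only [Fintype.sum_option, hnone, hsome]
  simp only [frame, zero_mul, neg_zero, Finset.sum_const_zero, add_zero]
  suffices h : ∀ x : Space m, Ω.indicator (P none).1 (x, 0)
      = σ * Ω.indicator (P (some none)).1 (x, 0) by
    simp only [h, integral_const_mul]
    ring
  intro x
  by_cases hx : ((x, 0) : SpaceTime m) ∈ Ω
  · have hx0 : ((x, 0) : SpaceTime m) ∈ halfSpace m := le_refl (0 : ℝ)
    have htan : ∀ u : Space m, ev (x, 0) (dirD (u, 0) v) = 0 := by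
      intro u
      refine ev_dirD_eq_zero_of_ray hx0 le_rfl ?_
      have hc : Continuous fun r : ℝ => normSq (x + r • u) :=
        continuous_normSq.comp (by fun_prop)
      have hev : ∀ᶠ r in 𝓝 (0 : ℝ), 1 < normSq (x + r • u) :=
        continuousAt_const.eventually_lt hc.continuousAt (by simpa using hx.1)
      filter_upwards [nhdsWithin_le_nhds hev] with r hr
      simpa using h0 _ hr
    have hy : ∀ i, ev (x, 0) (frameD m σ (some (some i)) v) = 0 := fun i => htan _
    have hz : ev (x, 0) (frameD m σ (some none) v) + σ * ev (x, 0) (frameD m σ none v) = 0 := by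
      have := htan (0, 1)
      rwa [dirD_z_eq σ, map_add, map_smul, smul_eq_mul] at this
    simp only [indicator_of_mem hx, ← ev_apply, P, energyFlux, map_neg, map_mul, map_ofNat,
      ev_gradSq, hy]
    set d := ev (x, 0) (frameD m σ none v)
    rw [eq_neg_of_add_eq_zero_left hz]
    have hd : σ ^ 2 * d ^ 2 = d ^ 2 := by rw [hσ, one_mul]
    simp
    linear_combination (-ev (x, 0) (coneElt m σ T R)) * hd
  · simp [indicator_of_notMem hx]

/-- Continuous functions that agree almost everywhere on an open subset of the open half space
agree there. -/
theorem ev_eq_zero_of_ae {f : smoothAlg m} {Ω : Set (SpaceTime m)} (hΩ : IsOpen Ω)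
    (h : ∀ᵐ p ∂(halfMeasure m), p ∈ Ω → ev p f = 0) :
    ∀ p ∈ Ω, 0 < p.2 → ev p f = 0 := by
  have : (volume : Measure (Space m)).IsOpenPosMeasure := by
    rw [Measure.volume_eq_prod]; infer_instance
  have : (volume : Measure (SpaceTime m)).IsOpenPosMeasure := by
    rw [Measure.volume_eq_prod]; infer_instance
  have hpos : IsOpen {p : SpaceTime m | 0 < p.2} := isOpen_lt continuous_const continuous_snd
  have hU : IsOpen ({p : SpaceTime m | 0 < p.2} ∩ Ω) := hpos.inter hΩ
  rw [halfMeasure_eq, ← ae_restrict_iff' hΩ.measurableSet, Measure.restrict_restrict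
    hΩ.measurableSet, inter_comm] at h
  have heq := Measure.eqOn_open_of_ae_eq (f := fun p => ev p f) (g := fun _ => 0) h hU
    ((continuousOn_ev f).mono fun p (hp : 0 < p.2 ∧ p ∈ Ω) => hp.1.le) continuousOn_const
  exact fun p hp hp0 => heq ⟨hp0, hp⟩

theorem frameD_none_eq_zero_of_mem_coneRegion {σ T R : ℝ} (hσ : σ ^ 2 = 1) (hT : 0 < T)
    (hTR : T < R) {v : smoothAlg m}
    (hL : ∀ p : SpaceTime m, 0 < p.2 → 1 < normSq p.1 →
      ev p (quadOp (frameD m σ) waveSign v) = 0)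
    (h0 : ∀ x : Space m, 1 < normSq x → ev (x, 0) v = 0)
    (hic : ∀ p ∈ halfSpace m, p.2 + σ * p.1.2 < -1 → ev p v = 0)
    (hdata : ∀ p ∈ halfSpace m, normSq p.1 = 1 → p.2 + σ * p.1.2 ≤ T → ev p v = 0) :
    ∀ p ∈ coneRegion m σ T R, 0 < p.2 → ev p (frameD m σ none v) = 0 := by
  set Ω := coneRegion m σ T R
  set P := energyFlux (frameD m σ) (coneElt m σ T R) v
  set F := ∑ k, frameD m σ k (P k) with hF
  have hΩ : IsOpen Ω := isOpen_coneRegion m σ T R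
  have hFge : ∀ p ∈ Ω, 0 < p.2 → ((R - (p.2 + σ * p.1.2)) ^ 2 - normSq p.1)
      * ev p (gradSq (frameD m σ) v) ≤ ev p F := by
    intro p hp hp0
    have h1 := ev_coneElt_energy_ge v (le_of_lt hp0 : p ∈ halfSpace m) hp.2.1 hTR hp.2.2
    rwa [hF, energy_identity (frameD m σ) (fun k l f => frameD_comm σ k l f), add_sub_assoc,
      map_add, map_mul _ _ (quadOp _ _ _), hL p hp0 hp.1, mul_zero, zero_add]
  have hg0 : ∀ p, 0 ≤ ev p (gradSq (frameD m σ) v) := fun p =>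
    (sq_nonneg _).trans (frameD_sq_le_gradSq σ none v p)
  have hFi : Integrable (Ω.indicator F.1) (halfMeasure m) := by
    refine integrable_indicator_of_bddOn hΩ (R := T + R + 1) fun p hp hpΩ hpR => ?_
    rw [← ev_apply, hF, map_sum]
    exact Finset.sum_eq_zero fun k _ =>
      (bddOn_energyFlux hσ hT hTR hic k).dirD hΩ (frame m σ k) p hp hpΩ hpR
  have hae : Ω.indicator F.1 =ᵐ[halfMeasure m] 0 := by
    refine (integral_eq_zero_iff_of_nonneg_ae ?_ hFi).1
      (integral_energyFlux_eq hσ hT hTR h0 hic hdata)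
    filter_upwards [ae_halfMeasure] with p hp
    refine indicator_apply_nonneg fun hpΩ => ?_
    exact (mul_nonneg (sub_nonneg.2 hpΩ.2.2.le) (hg0 p)).trans (hFge p hpΩ hp)
  have hzero := ev_eq_zero_of_ae (f := F) hΩ (by
    filter_upwards [hae] with p hp hpΩ
    rwa [indicator_of_mem hpΩ] at hp)
  intro p hp hp0
  have h1 := (hFge p hp hp0).trans_eq (hzero p hp hp0)
  have h2 : ev p (gradSq (frameD m σ) v) ≤ 0 :=
    nonpos_of_mul_nonpos_right h1 (sub_pos.2 hp.2.2)
  exact pow_eq_zero_iff two_ne_zero |>.1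
    (le_antisymm ((frameD_sq_le_gradSq σ none v p).trans h2) (sq_nonneg _))

/-- Unique continuation in the exterior of the unit ball. -/
theorem exterior_vanishing {σ T : ℝ} (hσ : σ ^ 2 = 1) (hT : 0 < T) {v : smoothAlg m}
    (hL : ∀ p : SpaceTime m, 0 < p.2 → 1 < normSq p.1 →
      ev p (quadOp (frameD m σ) waveSign v) = 0)
    (h0 : ∀ x : Space m, 1 < normSq x → ev (x, 0) v = 0)
    (hic : ∀ p ∈ halfSpace m, p.2 + σ * p.1.2 < -1 → ev p v = 0)
    (hdata : ∀ p ∈ halfSpace m, normSq p.1 = 1 → p.2 + σ * p.1.2 ≤ T → ev p v = 0)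
    {p : SpaceTime m} (hp : p ∈ halfSpace m) (hx : 1 ≤ normSq p.1)
    (ht : p.2 + σ * p.1.2 < T) : ev p v = 0 := by
  rcases hx.eq_or_lt with hx | hx
  · exact hdata p hp hx.symm ht.le
  set R := T + normSq p.1
  have hline : ∀ r : ℝ, 0 < r → r ≤ p.2 → ev (p.1, r) (dirD (0, 1) v) = 0 := by
    intro r hr hrp
    refine frameD_none_eq_zero_of_mem_coneRegion hσ hT (by linarith : T < R) hL h0 hic hdata
      (p.1, r) ⟨hx, ?_, ?_⟩ hr
    · show r + σ * p.1.2 < T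
      linarith
    · show normSq p.1 < (R - (r + σ * p.1.2)) ^ 2
      have : normSq p.1 < R - (r + σ * p.1.2) := by linarith
      nlinarith
  have hsub : ∀ r : ℝ, ((p.1, 0) : SpaceTime m) + r • ((0, 1) : SpaceTime m) = (p.1, r) := by
    intro r; ext <;> simp
  have hder : ∀ r ∈ Icc 0 p.2, HasDerivWithinAt (fun r : ℝ => ev (p.1, r) v)
      (ev (p.1, r) (dirD (0, 1) v)) (Icc 0 p.2) r := by
    intro r hr
    have := hasDerivWithinAt_line v (p.1, 0) (0, 1) (I := Icc 0 p.2) (r := r)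
      (fun u hu => by dsimp only; rw [hsub]; exact hu.1) (by rw [hsub]; exact hr.1)
    simp only [hsub] at this
    exact this
  rcases (show 0 ≤ p.2 from hp).eq_or_lt with hp0 | hp0
  · rw [← h0 p.1 hx, show p = (p.1, 0) from Prod.ext rfl hp0.symm]
  obtain ⟨c, hc, hslope⟩ := exists_hasDerivAt_eq_slope (fun r : ℝ => ev (p.1, r) v)
    (fun r => ev (p.1, r) (dirD (0, 1) v)) hp0 (fun r hr => (hder r hr).continuousWithinAt)
    fun r hr => (hder r (Ioo_subset_Icc_self hr)).hasDerivAt (Icc_mem_nhds hr.1 hr.2)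
  simp only [hline c hc.1 hc.2.le, h0 p.1 hx] at hslope
  have := (div_eq_zero_iff.1 hslope.symm).resolve_right (by linarith)
  linarith

theorem ev_weight_eq_slice (x : Space m) (s : ℝ) :
    ev (x, s) (weight m) = ev (x, 0) (weight m) * Real.exp (-(25 * s ^ 2)) := by
  rw [ev_weight, ev_weight, ev_phase, ev_phase, ← Real.exp_add]
  congr 1
  ring

theorem two_le_ev_weight_slice {x : Space m} (hx : normSq x ≤ 1) : 2 ≤ ev (x, 0) (weight m) := by
  have hy : 0 ≤ ∑ i, x.1 i ^ 2 := Finset.sum_nonneg fun i _ => sq_nonneg _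
  have hz : x.2 ≤ 1 := by
    unfold normSq at hx
    nlinarith
  have h : (5 : ℝ) ≤ 50 * ev (x, 0) (phase m) := by
    rw [ev_phase]
    dsimp only
    nlinarith
  rw [ev_weight]
  linarith [Real.add_one_le_exp (50 * ev (x, 0) (phase m))]

theorem ev_weight_le_one {p : SpaceTime m} (hx : normSq p.1 ≤ 1) (hs : 5 ≤ p.2) :
    ev p (weight m) ≤ 1 := by
  have hy : 0 ≤ ∑ i, p.1.1 i ^ 2 := Finset.sum_nonneg fun i _ => sq_nonneg _
  rw [ev_weight, Real.exp_le_one_iff, ev_phase]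
  unfold normSq at hx
  have hz : -1 ≤ p.1.2 := by nlinarith
  nlinarith

/-- The decay in `s` of the squared exponential weight relative to its trace. -/
noncomputable def decay (τ s : ℝ) : ℝ := Real.exp (-(2 * τ * (1 - Real.exp (-(25 * s ^ 2)))))

theorem ev_expWeight_sq_le {τ : ℝ} (hτ : 0 ≤ τ) {x : Space m} (hx : normSq x ≤ 1) (s : ℝ) :
    ev (x, s) (expWeight m τ) ^ 2 ≤ ev (x, 0) (expWeight m τ) ^ 2 * decay τ s := by
  rw [decay, ev_expWeight, ev_expWeight, ← Real.exp_nat_mul, ← Real.exp_nat_mul, ← Real.exp_add,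
    Real.exp_le_exp, ev_weight_eq_slice]
  have h1 := two_le_ev_weight_slice hx
  have h2 : Real.exp (-(25 * s ^ 2)) ≤ 1 := Real.exp_le_one_iff.2 (by nlinarith [sq_nonneg s])
  push_cast
  nlinarith [mul_nonneg hτ (mul_nonneg (by linarith : 0 ≤ ev (x, 0) (weight m) - 1)
    (sub_nonneg.2 h2))]

/-- The total decay for `0 < s < 5`. -/
noncomputable def totalDecay (τ : ℝ) : ℝ := ∫ s in Ioi (0 : ℝ), (Iio 5).indicator (decay τ) s

theorem integrable_indicator_Iio : Integrable ((Iio (5 : ℝ)).indicator fun _ => (1 : ℝ))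
    (volume.restrict (Ioi 0)) := by
  rw [integrable_indicator_iff measurableSet_Iio]
  refine integrableOn_const ?_
  rw [Measure.restrict_apply measurableSet_Iio]
  refine ne_top_of_le_ne_top ?_ (measure_mono (t := Icc 0 5) fun s hs => ⟨hs.2.le, hs.1.le⟩)
  simp

theorem continuous_decay (τ : ℝ) : Continuous (decay τ) := by
  unfold decay; fun_prop

theorem norm_indicator_decay_le {τ : ℝ} (hτ : 0 ≤ τ) (s : ℝ) :
    ‖(Iio (5 : ℝ)).indicator (decay τ) s‖ ≤ (Iio (5 : ℝ)).indicator (fun _ => (1 : ℝ)) s := by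
  rw [norm_indicator_eq_indicator_norm]
  refine indicator_le_indicator ?_
  rw [decay, Real.norm_eq_abs, Real.abs_exp, Real.exp_le_one_iff]
  have h2 : Real.exp (-(25 * s ^ 2)) ≤ 1 := Real.exp_le_one_iff.2 (by nlinarith [sq_nonneg s])
  nlinarith [mul_nonneg hτ (sub_nonneg.2 h2)]

theorem aestronglyMeasurable_indicator_decay (τ : ℝ) :
    AEStronglyMeasurable ((Iio (5 : ℝ)).indicator (decay τ)) (volume.restrict (Ioi 0)) :=
  ((continuous_decay τ).stronglyMeasurable.indicator measurableSet_Iio).aestronglyMeasurable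

theorem integrable_indicator_decay {τ : ℝ} (hτ : 0 ≤ τ) :
    Integrable ((Iio (5 : ℝ)).indicator (decay τ)) (volume.restrict (Ioi 0)) :=
  integrable_indicator_Iio.mono' (aestronglyMeasurable_indicator_decay τ)
    (Eventually.of_forall (norm_indicator_decay_le hτ))

theorem tendsto_totalDecay : Tendsto totalDecay atTop (𝓝 0) := by
  have h := tendsto_integral_filter_of_dominated_convergence (l := atTop)
    (μ := volume.restrict (Ioi (0 : ℝ))) (F := fun τ => (Iio (5 : ℝ)).indicator (decay τ))
    (f := fun _ => (0 : ℝ)) ((Iio (5 : ℝ)).indicator fun _ => (1 : ℝ))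
    (Eventually.of_forall aestronglyMeasurable_indicator_decay)
    ((eventually_ge_atTop 0).mono fun τ hτ =>
      Eventually.of_forall (norm_indicator_decay_le hτ)) integrable_indicator_Iio ?_
  · rw [integral_zero] at h
    exact h
  filter_upwards [ae_restrict_mem measurableSet_Ioi] with s hs
  by_cases h5 : s ∈ Iio (5 : ℝ)
  · simp only [indicator_of_mem h5, decay]
    have h2 : 0 < 1 - Real.exp (-(25 * s ^ 2)) := by
      rw [sub_pos, Real.exp_lt_one_iff]
      have := pow_pos (mem_Ioi.1 hs) 2
      linarith
    refine Real.tendsto_exp_neg_atTop_nhds_zero.comp ?_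
    exact (tendsto_id.const_mul_atTop two_pos).atTop_mul_const h2
  · simp only [indicator_of_notMem h5]
    exact tendsto_const_nhds

/-- The weighted norm of the source term. -/
theorem integral_expWeight_source_le {σ : ℝ} {V W Q u : smoothAlg m} (hV : V ∈ vanishIdeal m)
    (hW : W ∈ vanishIdeal m)
    (hF : ∀ p ∈ carlemanRegion m, 0 < p.2 → p.2 < 5 →
      ev p (quadOp (frameD m σ) waveSign V) = ev p Q * ev p V + ev (p.1, 0) W * ev p u) :
    ∃ A B K : ℝ, 0 ≤ A ∧ 0 ≤ B ∧ 0 ≤ K ∧ ∀ τ, 0 ≤ τ →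
      ∫ p, ev p (expWeight m τ * quadOp (frameD m σ) waveSign V) ^ 2 ∂(halfMeasure m)
        ≤ A * (∫ p, ev p (expWeight m τ * V) ^ 2 ∂(halfMeasure m))
          + B * ((∫ x : Space m, ev (x, 0) (expWeight m τ * W) ^ 2) * totalDecay τ)
          + K * Real.exp (2 * τ) := by
  set F := quadOp (frameD m σ) waveSign V
  have hFm : F ∈ vanishIdeal m := quadOp_mem_vanishIdeal hV σ
  obtain ⟨a, ha, hQ⟩ := exists_bound_carlemanRegion Q
  obtain ⟨b, hb, hu⟩ := exists_bound_carlemanRegion u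
  obtain ⟨k, hk, hFk⟩ := exists_bound_carlemanRegion F
  have hreg : MeasurableSet (carlemanRegion m) := (isCompact_carlemanRegion m).measurableSet
  refine ⟨2 * a ^ 2, 2 * b ^ 2, k ^ 2 * (halfMeasure m).real (carlemanRegion m), by positivity,
    by positivity, by positivity, fun τ hτ => ?_⟩
  have hEm : ∀ f ∈ vanishIdeal m, expWeight m τ * f ∈ vanishIdeal m := fun f hf =>
    Ideal.mul_mem_left _ _ hf
  have i1 := (integrable_sq_of_mem_vanishIdeal (hEm V hV)).const_mul (2 * a ^ 2)
  have i2 : Integrable (fun p : SpaceTime m => 2 * b ^ 2 * (ev (p.1, 0) (expWeight m τ * W) ^ 2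
      * (Iio (5 : ℝ)).indicator (decay τ) p.2)) (halfMeasure m) := by
    have i2' : Integrable fun x : Space m => ev (x, 0) (expWeight m τ * W) ^ 2 := by
      simpa only [map_pow] using integrable_slice_of_mem_vanishIdeal
        (Ideal.pow_mem_of_mem _ (hEm W hW) 2 two_pos)
    exact (i2'.mul_prod (integrable_indicator_decay hτ)).const_mul _
  have i3 : Integrable ((carlemanRegion m).indicator fun _ => k ^ 2 * Real.exp (2 * τ))
      (halfMeasure m) := by
    rw [integrable_indicator_iff hreg]
    refine integrableOn_const ?_
    rw [halfMeasure_eq]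
    exact ((Measure.restrict_apply_le _ _).trans_lt
      (isCompact_carlemanRegion m).measure_lt_top).ne
  have e2 : ∫ p : SpaceTime m, 2 * b ^ 2 * (ev (p.1, 0) (expWeight m τ * W) ^ 2
      * (Iio (5 : ℝ)).indicator (decay τ) p.2) ∂(halfMeasure m)
      = 2 * b ^ 2 * ((∫ x : Space m, ev (x, 0) (expWeight m τ * W) ^ 2) * totalDecay τ) := by
    rw [integral_const_mul, halfMeasure, totalDecay]
    congr 1
    exact integral_prod_mul (fun x : Space m => ev (x, 0) (expWeight m τ * W) ^ 2)
      ((Iio (5 : ℝ)).indicator (decay τ))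
  have e3 : ∫ p, (carlemanRegion m).indicator (fun _ => k ^ 2 * Real.exp (2 * τ)) p
      ∂(halfMeasure m) = k ^ 2 * (halfMeasure m).real (carlemanRegion m) * Real.exp (2 * τ) := by
    rw [integral_indicator_const _ hreg, smul_eq_mul]
    ring
  have i12 := i1.add i2
  simp only [Pi.add_def] at i12
  rw [← e2, ← e3, ← integral_const_mul, ← integral_add i1 i2, ← integral_add i12 i3]
  refine integral_mono_ae (integrable_sq_of_mem_vanishIdeal (hEm F hFm)) (i12.add i3) ?_
  filter_upwards [ae_halfMeasure] with p hp
  have hpos : 0 ≤ (Iio (5 : ℝ)).indicator (decay τ) p.2 :=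
    indicator_nonneg (fun s _ => (Real.exp_pos _).le) _
  have hind : 0 ≤ (carlemanRegion m).indicator (fun _ => k ^ 2 * Real.exp (2 * τ)) p :=
    indicator_nonneg (fun s _ => by positivity) _
  by_cases hpK : p ∈ carlemanRegion m
  · rcases lt_or_ge p.2 5 with h5 | h5
    · refine le_add_of_le_of_nonneg ?_ hind
      rw [indicator_of_mem (mem_Iio.2 h5)]
      have hE := ev_expWeight_sq_le hτ hpK.2.1 p.2
      have hq := sq_le_sq' (neg_le_of_abs_le (hQ p hpK)) (le_of_abs_le (hQ p hpK))
      have hu' := sq_le_sq' (neg_le_of_abs_le (hu p hpK)) (le_of_abs_le (hu p hpK))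
      simp only [map_mul, F, hF p hpK hp h5]
      rw [Prod.mk.eta] at hE
      set E := ev p (expWeight m τ)
      set E₀ := ev (p.1, 0) (expWeight m τ)
      set w := ev (p.1, 0) W
      set Qp := ev p Q
      set Vp := ev p V
      set up := ev p u
      set d := decay τ p.2
      have h1 : (E * Vp) ^ 2 * Qp ^ 2 ≤ (E * Vp) ^ 2 * a ^ 2 := by gcongr
      have h2 : w ^ 2 * (E ^ 2 * up ^ 2) ≤ w ^ 2 * ((E₀ ^ 2 * d) * b ^ 2) := by
        have := (sq_nonneg E).trans hE
        gcongr
      have h3 := sq_nonneg (E * Qp * Vp - E * w * up)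
      nlinarith
    · refine le_add_of_nonneg_of_le (by positivity) ?_
      rw [indicator_of_mem hpK, map_mul, mul_pow, mul_comm]
      have h1 := sq_le_sq' (neg_le_of_abs_le (hFk p hpK)) (le_of_abs_le (hFk p hpK))
      have h2 : ev p (expWeight m τ) ^ 2 ≤ Real.exp (2 * τ) := by
        rw [ev_expWeight, ← Real.exp_nat_mul, Real.exp_le_exp]
        have := ev_weight_le_one hpK.2.1 h5
        push_cast
        nlinarith
      gcongr
  · simp only [hEm F hFm p (le_of_lt hp) hpK, zero_pow two_ne_zero]
    positivity

theorem exists_cutoff (m : ℕ) {δ : ℝ} (hδ : 0 < δ) : ∃ c : smoothAlg m,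
    (∀ p : SpaceTime m, p.2 ≤ 5 → normSq p.1 ≤ 1 + δ → ev p c = 1) ∧
      ∀ p : SpaceTime m, 5 + δ ≤ p.2 ∨ 1 + 2 * δ ≤ normSq p.1 → ev p c = 0 := by
  refine ⟨⟨fun p => Real.smoothTransition ((5 + δ - p.2) / δ)
    * Real.smoothTransition ((1 + 2 * δ - normSq p.1) / δ), ContDiff.contDiffOn ?_⟩, ?_, ?_⟩
  · refine (Real.smoothTransition.contDiff.comp ?_).mul (Real.smoothTransition.contDiff.comp ?_)
    · fun_prop
    · unfold normSq; fun_prop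
  · intro p h1 h2
    rw [ev_apply]
    dsimp only
    rw [Real.smoothTransition.one_of_one_le, Real.smoothTransition.one_of_one_le, one_mul]
    · rw [le_div_iff₀ hδ]; linarith
    · rw [le_div_iff₀ hδ]; linarith
  · intro p h
    rw [ev_apply]
    dsimp only
    rcases h with h | h
    · rw [Real.smoothTransition.zero_of_nonpos, zero_mul]
      exact div_nonpos_of_nonpos_of_nonneg (by linarith) hδ.le
    · rw [mul_comm, Real.smoothTransition.zero_of_nonpos, zero_mul]
      exact div_nonpos_of_nonpos_of_nonneg (by linarith) hδ.le

theorem cutoff_mul_mem_vanishIdeal {σ T δ : ℝ} (hσ : σ ^ 2 = 1) (hδ : 0 < δ) (hδ1 : δ ≤ 1)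
    (hT : 6 + 2 * δ ≤ T) {c v : smoothAlg m}
    (hc : ∀ p : SpaceTime m, 5 + δ ≤ p.2 ∨ 1 + 2 * δ ≤ normSq p.1 → ev p c = 0)
    (hv : ∀ p ∈ halfSpace m, 1 ≤ normSq p.1 → p.2 + σ * p.1.2 < T → ev p v = 0) :
    c * v ∈ vanishIdeal m := by
  intro p hp hpK
  rw [map_mul]
  by_cases h : 5 + δ ≤ p.2 ∨ 1 + 2 * δ ≤ normSq p.1
  · rw [hc p h, zero_mul]
  push Not at h
  have h1 : 1 < normSq p.1 := by
    by_contra! h1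
    exact hpK ⟨hp, h1, by linarith⟩
  rw [hv p hp h1.le, mul_zero]
  have hz : |σ * p.1.2| ≤ 1 + δ := by
    rw [abs_mul, abs_eq_one_of_sq hσ, one_mul]
    refine abs_le_of_sq_le_sq ?_ (by linarith)
    have := h.2
    have hy : 0 ≤ ∑ i, p.1.1 i ^ 2 := Finset.sum_nonneg fun i _ => sq_nonneg _
    unfold normSq at this
    nlinarith
  linarith [le_of_abs_le hz]

theorem ev_quadOp_congr (σ : ℝ) {f g : smoothAlg m} {U : Set (SpaceTime m)} (hU : IsOpen U)
    (h : ∀ p ∈ U, p ∈ halfSpace m → ev p f = ev p g) {p : SpaceTime m} (hpU : p ∈ U)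
    (hp : p ∈ halfSpace m) :
    ev p (quadOp (frameD m σ) waveSign f) = ev p (quadOp (frameD m σ) waveSign g) := by
  simp only [quadOp, map_sum, map_mul]
  refine Finset.sum_congr rfl fun k _ => ?_
  congr 1
  exact ev_dirD_congr _ hU (ev_dirD_congr _ hU h) p hpU hp

/-- A quantity dominated with a vanishing factor by itself and by an exponentially smaller term
is zero. -/
theorem nonpos_of_exp_estimate {C A B K N₀ : ℝ} {γ D N : ℝ → ℝ}
    (hγ : Tendsto γ atTop (𝓝 0)) (hN : ∀ τ, 0 ≤ N τ)
    (hD : ∀ τ, 0 ≤ τ → Real.exp (4 * τ) * N₀ ≤ D τ) (hD0 : ∀ τ, 0 ≤ D τ)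
    (h : ∀ᶠ τ in atTop, D τ + τ ^ 3 * N τ
      ≤ C * (A * N τ + B * (D τ * γ τ) + K * Real.exp (2 * τ))) : N₀ ≤ 0 := by
  have h1 : ∀ᶠ τ in atTop, C * B * γ τ < 1 / 2 := by
    have : Tendsto (fun τ => C * B * γ τ) atTop (𝓝 (C * B * 0)) := hγ.const_mul _
    rw [mul_zero] at this
    exact this.eventually_lt_const (by norm_num)
  have h2 : ∀ᶠ τ : ℝ in atTop, C * A ≤ τ ^ 3 :=
    (tendsto_pow_atTop (by norm_num)).eventually_ge_atTop _
  have h3 : ∀ᶠ τ : ℝ in atTop, N₀ ≤ 2 * C * K * Real.exp (-(2 * τ)) := by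
    filter_upwards [h, h1, h2, eventually_ge_atTop 0] with τ h h1 h2 h0
    have e1 : C * B * γ τ * D τ ≤ 1 / 2 * D τ := mul_le_mul_of_nonneg_right h1.le (hD0 τ)
    have e2 : C * A * N τ ≤ τ ^ 3 * N τ := mul_le_mul_of_nonneg_right h2 (hN τ)
    have e3 : Real.exp (4 * τ) * N₀ ≤ 2 * C * K * Real.exp (2 * τ) := by
      have := hD τ h0
      nlinarith
    rw [← mul_le_mul_iff_right₀ (Real.exp_pos (4 * τ))]
    refine e3.trans_eq ?_
    rw [mul_left_comm, ← Real.exp_add]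
    congr 2
    ring
  have h4 : Tendsto (fun τ : ℝ => 2 * C * K * Real.exp (-(2 * τ))) atTop (𝓝 (2 * C * K * 0)) :=
    (Real.tendsto_exp_neg_atTop_nhds_zero.comp
      (tendsto_id.const_mul_atTop two_pos)).const_mul _
  rw [mul_zero] at h4
  exact ge_of_tendsto h4 h3

theorem slice_eq_zero_of_integral_sq_nonpos {W : smoothAlg m} (hW : W ∈ vanishIdeal m)
    (h : ∫ x : Space m, ev (x, 0) W ^ 2 ≤ 0) (x : Space m) : ev (x, 0) W = 0 := by
  have hc : Continuous fun x : Space m => ev (x, 0) W ^ 2 :=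
    ((continuousOn_ev W).comp_continuous (by fun_prop) (fun x => by simp [halfSpace])).pow 2
  have hi : Integrable fun x : Space m => ev (x, 0) W ^ 2 := by
    simpa only [map_pow] using integrable_slice_of_mem_vanishIdeal
      (Ideal.pow_mem_of_mem _ hW 2 two_pos)
  have h0 : (fun x : Space m => ev (x, 0) W ^ 2) =ᵐ[volume] 0 :=
    (integral_eq_zero_iff_of_nonneg (fun x => sq_nonneg _) hi).1
      (le_antisymm h (integral_nonneg fun x => sq_nonneg _))
  have := congrFun ((hc.ae_eq_iff_eq volume continuous_zero).1 h0) x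
  exact pow_eq_zero_iff two_ne_zero |>.1 this

theorem slice_mem_halfSpace (x : Space m) : (x, 0) ∈ halfSpace m := le_refl (0 : ℝ)

theorem exp_mul_integral_slice_le {W : smoothAlg m} (hW : W ∈ vanishIdeal m) {τ : ℝ}
    (hτ : 0 ≤ τ) : Real.exp (4 * τ) * ∫ x : Space m, ev (x, 0) W ^ 2
      ≤ ∫ x : Space m, ev (x, 0) (expWeight m τ * W) ^ 2 := by
  have hi : ∀ f ∈ vanishIdeal m, Integrable fun x : Space m => ev (x, 0) f ^ 2 := fun f hf => by
    simpa only [map_pow] using integrable_slice_of_mem_vanishIdeal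
      (Ideal.pow_mem_of_mem _ hf 2 two_pos)
  rw [← integral_const_mul]
  refine integral_mono ((hi W hW).const_mul _) (hi _ (Ideal.mul_mem_left _ _ hW)) fun x => ?_
  dsimp only
  by_cases hx : normSq x ≤ 1
  · rw [map_mul, mul_pow]
    gcongr
    rw [ev_expWeight, ← Real.exp_nat_mul, Real.exp_le_exp]
    have := two_le_ev_weight_slice hx
    push_cast
    nlinarith
  · have : ev (x, 0) W = 0 := hW (x, 0) (slice_mem_halfSpace x) fun h => hx h.2.1
    simp [this]

/-- The two wave fields determine the difference of the potentials. -/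
theorem potential_eq_zero {T : ℝ} (hT : 6 < T) {vp vm Q up um : smoothAlg m} {g : Space m → ℝ}
    (hslice : ∀ x, ev (x, 0) vp = ev (x, 0) vm)
    (hp : ∀ p : SpaceTime m, 0 < p.2 → ev p (quadOp (frameD m 1) waveSign vp)
      = ev p Q * ev p vp + g p.1 * ev p up)
    (hm : ∀ p : SpaceTime m, 0 < p.2 → ev p (quadOp (frameD m (-1)) waveSign vm)
      = ev p Q * ev p vm + g p.1 * ev p um)
    (hg : ∀ x, normSq x ≤ 1 → ev (x, 0) (dirD ((0, 1), 0) vp) = -(1 / 2) * g x)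
    (hextp : ∀ p ∈ halfSpace m, 1 ≤ normSq p.1 → p.2 + 1 * p.1.2 < T → ev p vp = 0)
    (hextm : ∀ p ∈ halfSpace m, 1 ≤ normSq p.1 → p.2 + -1 * p.1.2 < T → ev p vm = 0)
    {x : Space m} (hx : normSq x ≤ 1) : g x = 0 := by
  obtain ⟨δ, hδ, hδ1, hδT⟩ : ∃ δ : ℝ, 0 < δ ∧ δ ≤ 1 ∧ 6 + 2 * δ ≤ T :=
    ⟨min ((T - 6) / 4) 1, lt_min (by linarith) one_pos, min_le_right _ _,
      by linarith [min_le_left ((T - 6) / 4) 1]⟩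
  obtain ⟨c, hc1, hc0⟩ := exists_cutoff m hδ
  have hVp : c * vp ∈ vanishIdeal m :=
    cutoff_mul_mem_vanishIdeal (by norm_num) hδ hδ1 hδT hc0 hextp
  have hVm : c * vm ∈ vanishIdeal m :=
    cutoff_mul_mem_vanishIdeal (by norm_num) hδ hδ1 hδT hc0 hextm
  set U : Set (SpaceTime m) := {p | p.2 < 5 ∧ normSq p.1 < 1 + δ}
  have hU : IsOpen U := (isOpen_lt continuous_snd continuous_const).inter
    (isOpen_lt continuous_normSq_fst continuous_const)
  have hcU : ∀ f : smoothAlg m, ∀ p ∈ U, p ∈ halfSpace m → ev p (c * f) = ev p f :=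
    fun f p hpU _ => by rw [map_mul, hc1 p hpU.1.le hpU.2.le, one_mul]
  set W := dirD ((0, 1), 0) (c * vp)
  have hW : W ∈ vanishIdeal m := dirD_mem_vanishIdeal hVp _
  have hWg : ∀ x : Space m, normSq x ≤ 1 → ev (x, 0) W = -(1 / 2) * g x := fun x hx => by
    rw [← hg x hx]
    exact ev_dirD_congr _ hU (hcU vp) (x, 0) ⟨by norm_num, by dsimp only; linarith⟩
      (slice_mem_halfSpace x)
  have hsource : ∀ (σ : ℝ) (v u : smoothAlg m),
      (∀ p : SpaceTime m, 0 < p.2 → ev p (quadOp (frameD m σ) waveSign v)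
        = ev p Q * ev p v + g p.1 * ev p u) →
      ∀ p ∈ carlemanRegion m, 0 < p.2 → p.2 < 5 →
        ev p (quadOp (frameD m σ) waveSign (c * v))
          = ev p Q * ev p (c * v) + ev (p.1, 0) W * ev p ((-2 : ℝ) • u) := by
    intro σ v u h p hpK h0 h5
    have hpU : p ∈ U := ⟨h5, by linarith [hpK.2.1]⟩
    rw [ev_quadOp_congr σ hU (hcU v) hpU hpK.1, hcU v p hpU hpK.1, h p h0, hWg _ hpK.2.1,
      map_smul, smul_eq_mul]
    ring
  obtain ⟨C, τ₀, hC, hτ₀, hcarl⟩ := carleman_estimate m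
  obtain ⟨A, B, K, hA, hB, hK, hbp⟩ :=
    integral_expWeight_source_le hVp hW (hsource 1 vp up hp)
  obtain ⟨A', B', K', hA', hB', hK', hbm⟩ :=
    integral_expWeight_source_le hVm hW (hsource (-1) vm um hm)
  have hfin : ∫ x : Space m, ev (x, 0) W ^ 2 ≤ 0 := by
    refine nonpos_of_exp_estimate (C := C) (A := A + A') (B := B + B') (K := K + K')
      (γ := totalDecay) (D := fun τ => ∫ x : Space m, ev (x, 0) (expWeight m τ * W) ^ 2)
      (N := fun τ => (∫ p, ev p (expWeight m τ * (c * vp)) ^ 2 ∂(halfMeasure m))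
        + ∫ p, ev p (expWeight m τ * (c * vm)) ^ 2 ∂(halfMeasure m))
      tendsto_totalDecay (fun τ => by positivity) (fun τ hτ => exp_mul_integral_slice_le hW hτ)
      (fun τ => by positivity) ?_
    filter_upwards [eventually_ge_atTop τ₀] with τ hτ
    have h0 : 0 ≤ τ := by linarith
    have h1 := hcarl τ hτ _ hVp _ hVm fun x => by rw [map_mul, map_mul, hslice]
    refine h1.trans (mul_le_mul_of_nonneg_left ?_ hC.le)
    have h2 := hbp τ h0
    have h3 := hbm τ h0
    set n₁ := ∫ p, ev p (expWeight m τ * (c * vp)) ^ 2 ∂(halfMeasure m)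
    set n₂ := ∫ p, ev p (expWeight m τ * (c * vm)) ^ 2 ∂(halfMeasure m)
    have hn₁ : 0 ≤ n₁ := integral_nonneg fun p => sq_nonneg _
    have hn₂ : 0 ≤ n₂ := integral_nonneg fun p => sq_nonneg _
    nlinarith [mul_nonneg hA hn₂, mul_nonneg hA' hn₁]
  have := slice_eq_zero_of_integral_sq_nonpos hW hfin x
  rw [hWg x hx] at this
  linarith

theorem iteratedDeriv_two_line (f : smoothAlg m) (e : SpaceTime m) {p : SpaceTime m}
    (hp : 0 < p.2) :
    iteratedDeriv 2 (fun r : ℝ => f.1 (p + r • e)) 0 = ev p (dirD e (dirD e f)) := by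
  have hopen : IsOpen {r : ℝ | 0 < (p + r • e).2} :=
    isOpen_lt continuous_const (by fun_prop)
  have hder : ∀ (f : smoothAlg m) (r : ℝ), 0 < (p + r • e).2 →
      HasDerivAt (fun r : ℝ => f.1 (p + r • e)) ((dirD e f).1 (p + r • e)) r := fun f r hr =>
    (hasDerivWithinAt_line f p e (I := {r : ℝ | 0 < (p + r • e).2})
      (fun r hr => le_of_lt (mem_ofPred_eq ▸ hr)) hr.le).hasDerivAt (hopen.mem_nhds hr)
  have h0 : 0 < (p + (0 : ℝ) • e).2 := by simpa using hp
  have heq : deriv (fun r : ℝ => f.1 (p + r • e)) =ᶠ[𝓝 0] fun r => (dirD e f).1 (p + r • e) := by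
    filter_upwards [hopen.mem_nhds h0] with r hr
    exact (hder f r hr).deriv
  rw [iteratedDeriv_succ, iteratedDeriv_one, heq.deriv_eq, (hder _ 0 h0).deriv, zero_smul,
    add_zero, ev_apply]

/-- A wave field in the coordinates `(x, s)` with `t = s + σ z`. -/
def pullback (σ : ℝ) (u : SpaceTime m → ℝ) (hu : ContDiffOn ℝ ∞ u {p | σ * p.1.2 ≤ p.2}) :
    smoothAlg m :=
  ⟨fun p => u (p.1, p.2 + σ * p.1.2), hu.comp (by fun_prop) fun p hp => by
    have : 0 ≤ p.2 := hp
    simpa using this⟩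

section

variable {σ : ℝ} {u u' : SpaceTime m → ℝ} {q q' : Space m → ℝ}
  (hu : ContDiffOn ℝ ∞ u {p | σ * p.1.2 ≤ p.2}) (hu' : ContDiffOn ℝ ∞ u' {p | σ * p.1.2 ≤ p.2})

theorem ev_pullback (p : SpaceTime m) : ev p (pullback σ u hu) = u (p.1, p.2 + σ * p.1.2) := rfl

theorem ev_quadOp_pullback {p : SpaceTime m} (hp : 0 < p.2) :
    ev p (quadOp (frameD m σ) waveSign (pullback σ u hu))
      = -waveOp m u (p.1, p.2 + σ * p.1.2) := by
  have key : ∀ (k) (e : SpaceTime m),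
      (∀ r : ℝ, ((p + r • frame m σ k).1, (p + r • frame m σ k).2
        + σ * (p + r • frame m σ k).1.2) = ((p.1, p.2 + σ * p.1.2) : SpaceTime m) + r • e) →
      ev p (frameD m σ k (frameD m σ k (pullback σ u hu)))
        = dir2 u (p.1, p.2 + σ * p.1.2) e := by
    intro k e he
    refine (iteratedDeriv_two_line (pullback σ u hu) (frame m σ k) hp).symm.trans ?_
    rw [dir2]
    congr 1
    funext r
    rw [← he]
    rfl
  simp only [quadOp, map_sum, map_add, map_mul, ev_algebraMap, Fintype.sum_option, waveSign, waveOp]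
  rw [key none (0, 1), key (some none) ((0, 1), 0)]
  · rw [Finset.sum_congr rfl fun i _ => by
      rw [key (some (some i)) ((EuclideanSpace.single i 1, 0), 0) (fun r => by simp [frame])]]
    simp only [one_mul]
    ring
  · intro r
    ext <;> simp [frame] <;> ring
  · intro r
    ext <;> simp [frame] <;> ring

theorem ev_quadOp_pullback_sub
    (hpde : ∀ p : SpaceTime m, σ * p.1.2 < p.2 → waveOp m u p + q p.1 * u p = 0)
    (hpde' : ∀ p : SpaceTime m, σ * p.1.2 < p.2 → waveOp m u' p + q' p.1 * u' p = 0)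
    {p : SpaceTime m} (hp : 0 < p.2) :
    ev p (quadOp (frameD m σ) waveSign (pullback σ u hu - pullback σ u' hu'))
      = q p.1 * ev p (pullback σ u hu) - q' p.1 * ev p (pullback σ u' hu') := by
  have hsub : quadOp (frameD m σ) waveSign (pullback σ u hu - pullback σ u' hu')
      = quadOp (frameD m σ) waveSign (pullback σ u hu)
        - quadOp (frameD m σ) waveSign (pullback σ u' hu') := by
    simp only [quadOp, map_sub, mul_sub, Finset.sum_sub_distrib]
  have h := hpde (p.1, p.2 + σ * p.1.2) (by dsimp only; linarith)
  have h' := hpde' (p.1, p.2 + σ * p.1.2) (by dsimp only; linarith)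
  rw [hsub, map_sub, ev_quadOp_pullback hu hp, ev_quadOp_pullback hu' hp, ev_pullback, ev_pullback]
  linear_combination h' - h

theorem ev_pullback_sub_eq_zero {T : ℝ} (hσ : σ ^ 2 = 1) (hT : 0 < T)
    (hpde : ∀ p : SpaceTime m, σ * p.1.2 < p.2 → waveOp m u p + q p.1 * u p = 0)
    (hpde' : ∀ p : SpaceTime m, σ * p.1.2 < p.2 → waveOp m u' p + q' p.1 * u' p = 0)
    (hq : ∀ x, 1 < normSq x → q x = 0) (hq' : ∀ x, 1 < normSq x → q' x = 0)
    (hic : ∀ p : SpaceTime m, σ * p.1.2 ≤ p.2 → p.2 < -1 → u p = 0)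
    (hic' : ∀ p : SpaceTime m, σ * p.1.2 ≤ p.2 → p.2 < -1 → u' p = 0)
    (hdata : ∀ p : SpaceTime m, normSq p.1 = 1 → p.2 ≤ T → σ * p.1.2 ≤ p.2 → u p = u' p)
    (h0 : ∀ x, 1 < normSq x → ev (x, 0) (pullback σ u hu - pullback σ u' hu') = 0) :
    ∀ p ∈ halfSpace m, 1 ≤ normSq p.1 → p.2 + σ * p.1.2 < T →
      ev p (pullback σ u hu - pullback σ u' hu') = 0 := by
  intro p hp hx ht
  refine exterior_vanishing hσ hT (fun p hp hx => ?_) h0 (fun p hp ht => ?_)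
    (fun p hp hx ht => ?_) hp hx ht
  · rw [ev_quadOp_pullback_sub hu hu' hpde hpde' hp, hq _ hx, hq' _ hx, zero_mul, zero_mul,
      sub_zero]
  · have hp : 0 ≤ p.2 := hp
    rw [map_sub, ev_pullback, ev_pullback, hic _ (by dsimp only; linarith) ht,
      hic' _ (by dsimp only; linarith) ht, sub_zero]
  · have hp : 0 ≤ p.2 := hp
    rw [map_sub, ev_pullback, ev_pullback,
      hdata (p.1, p.2 + σ * p.1.2) hx ht (by dsimp only; linarith), sub_self]

end

theorem one_lt_normSq_of_sq_le {y : EuclideanSpace ℝ (Fin m)} {z s : ℝ}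
    (h : 1 < normSq (y, z)) (hs : z ^ 2 ≤ s ^ 2) : 1 < normSq (y, s) := by
  rw [normSq_eq] at h ⊢
  dsimp only at h ⊢
  linarith

theorem integrable_line {g : Space m → ℝ} (hg : Continuous g)
    (hsupp : ∀ x, 1 < normSq x → g x = 0) (y : EuclideanSpace ℝ (Fin m)) :
    Integrable fun s : ℝ => g (y, s) := by
  refine (by fun_prop : Continuous fun s : ℝ => g (y, s)).integrable_of_hasCompactSupport ?_
  refine HasCompactSupport.of_support_subset_isCompact (isCompact_Icc (a := -1) (b := 1)) ?_
  intro s hs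
  have h : normSq (y, s) ≤ 1 := not_lt.1 fun h => hs (hsupp _ h)
  rw [normSq_eq] at h
  exact abs_le.1 (abs_le_of_sq_le_sq (by nlinarith [sq_nonneg ‖y‖]) zero_le_one)

theorem hasDerivAt_integral_Iic {f : ℝ → ℝ} (hf : Continuous f) (hi : Integrable f) (z : ℝ) :
    HasDerivAt (fun z => ∫ s in Iic z, f s) (f z) z := by
  have h : (fun z => ∫ s in Iic z, f s) = fun z => (∫ s in Iic 0, f s) + ∫ s in (0 : ℝ)..z, f s := by
    funext z
    rw [← intervalIntegral.integral_Iic_sub_Iic hi.integrableOn hi.integrableOn]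
    ring
  rw [h]
  exact (intervalIntegral.integral_hasDerivAt_right (hf.intervalIntegrable _ _)
    (hf.stronglyMeasurableAtFilter _ _) hf.continuousAt).const_add _

theorem integral_Iic_add_Ici {f : ℝ → ℝ} (hi : Integrable f) (z : ℝ) :
    (∫ s in Iic z, f s) + ∫ s in Ici z, f s = ∫ s, f s := by
  rw [integral_Ici_eq_integral_Ioi]
  exact intervalIntegral.integral_Iic_add_Ioi hi.integrableOn hi.integrableOn

/-- Theorem 1.2 (uniqueness part, two plane wave data): two smooth potentials supported in
the closed unit ball producing the same scattered waves on `Σ_l` (for the incoming plane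
wave `δ(t − z)`) and on `Σ_r` (for the incoming plane wave `δ(t + z)`), with `T > 6`,
must coincide. -/
theorem two_plane_wave_uniqueness (m : ℕ) (hm : 1 ≤ m) (T : ℝ) (hT : 6 < T)
    (q₁ q₂ : EuclideanSpace ℝ (Fin m) × ℝ → ℝ)
    (hq₁ : ContDiff ℝ (⊤ : ℕ∞) q₁) (hq₂ : ContDiff ℝ (⊤ : ℕ∞) q₂)
    (hq₁supp : ∀ y : EuclideanSpace ℝ (Fin m), ∀ z : ℝ, 1 < ‖y‖ ^ 2 + z ^ 2 → q₁ (y, z) = 0)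
    (hq₂supp : ∀ y : EuclideanSpace ℝ (Fin m), ∀ z : ℝ, 1 < ‖y‖ ^ 2 + z ^ 2 → q₂ (y, z) = 0)
    (u₁p u₂p u₁m u₂m : (EuclideanSpace ℝ (Fin m) × ℝ) × ℝ → ℝ)
    -- u_i^+ : scattered wave for the incoming direction e, smooth on {t ≥ z}
    (hu₁p_smooth : ContDiffOn ℝ (⊤ : ℕ∞) u₁p {p | p.1.2 ≤ p.2})
    (hu₂p_smooth : ContDiffOn ℝ (⊤ : ℕ∞) u₂p {p | p.1.2 ≤ p.2})
    (hu₁p_pde : ∀ p : (EuclideanSpace ℝ (Fin m) × ℝ) × ℝ, p.1.2 < p.2 →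
      waveOp m u₁p p + q₁ p.1 * u₁p p = 0)
    (hu₂p_pde : ∀ p : (EuclideanSpace ℝ (Fin m) × ℝ) × ℝ, p.1.2 < p.2 →
      waveOp m u₂p p + q₂ p.1 * u₂p p = 0)
    (hu₁p_char : ∀ y : EuclideanSpace ℝ (Fin m), ∀ z : ℝ,
      u₁p ((y, z), z) = -(1 / 2) * ∫ s in Set.Iic z, q₁ (y, s))
    (hu₂p_char : ∀ y : EuclideanSpace ℝ (Fin m), ∀ z : ℝ,
      u₂p ((y, z), z) = -(1 / 2) * ∫ s in Set.Iic z, q₂ (y, s))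
    (hu₁p_ic : ∀ y : EuclideanSpace ℝ (Fin m), ∀ z t : ℝ, z ≤ t → t < -1 →
      u₁p ((y, z), t) = 0)
    (hu₂p_ic : ∀ y : EuclideanSpace ℝ (Fin m), ∀ z t : ℝ, z ≤ t → t < -1 →
      u₂p ((y, z), t) = 0)
    -- u_i^- : scattered wave for the incoming direction −e, smooth on {t ≥ −z}
    (hu₁m_smooth : ContDiffOn ℝ (⊤ : ℕ∞) u₁m {p | -p.1.2 ≤ p.2})
    (hu₂m_smooth : ContDiffOn ℝ (⊤ : ℕ∞) u₂m {p | -p.1.2 ≤ p.2})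
    (hu₁m_pde : ∀ p : (EuclideanSpace ℝ (Fin m) × ℝ) × ℝ, -p.1.2 < p.2 →
      waveOp m u₁m p + q₁ p.1 * u₁m p = 0)
    (hu₂m_pde : ∀ p : (EuclideanSpace ℝ (Fin m) × ℝ) × ℝ, -p.1.2 < p.2 →
      waveOp m u₂m p + q₂ p.1 * u₂m p = 0)
    (hu₁m_char : ∀ y : EuclideanSpace ℝ (Fin m), ∀ z : ℝ,
      u₁m ((y, z), -z) = -(1 / 2) * ∫ s in Set.Ici z, q₁ (y, s))
    (hu₂m_char : ∀ y : EuclideanSpace ℝ (Fin m), ∀ z : ℝ,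
      u₂m ((y, z), -z) = -(1 / 2) * ∫ s in Set.Ici z, q₂ (y, s))
    (hu₁m_ic : ∀ y : EuclideanSpace ℝ (Fin m), ∀ z t : ℝ, -z ≤ t → t < -1 →
      u₁m ((y, z), t) = 0)
    (hu₂m_ic : ∀ y : EuclideanSpace ℝ (Fin m), ∀ z t : ℝ, -z ≤ t → t < -1 →
      u₂m ((y, z), t) = 0)
    -- the data agree on Σ_l and Σ_r
    (hdata_l : ∀ y : EuclideanSpace ℝ (Fin m), ∀ z t : ℝ,
      ‖y‖ ^ 2 + z ^ 2 = 1 → t ≤ T → z ≤ t → u₁p ((y, z), t) = u₂p ((y, z), t))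
    (hdata_r : ∀ y : EuclideanSpace ℝ (Fin m), ∀ z t : ℝ,
      ‖y‖ ^ 2 + z ^ 2 = 1 → t ≤ T → -z ≤ t → u₁m ((y, z), t) = u₂m ((y, z), t)) :
    q₁ = q₂ := by
  have hne : ∀ x : Space m, (1 < normSq x) = (1 < ‖x.1‖ ^ 2 + x.2 ^ 2) := fun x => by
    rw [normSq_eq]
  have hs₁ : ∀ x : Space m, 1 < normSq x → q₁ x = 0 := fun x hx => hq₁supp x.1 x.2 (hne x ▸ hx)
  have hs₂ : ∀ x : Space m, 1 < normSq x → q₂ x = 0 := fun x hx => hq₂supp x.1 x.2 (hne x ▸ hx)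
  have hi₁ := integrable_line hq₁.continuous hs₁
  have hi₂ := integrable_line hq₂.continuous hs₂
  have hp₁ : ContDiffOn ℝ ∞ u₁p {p | 1 * p.1.2 ≤ p.2} := by simpa only [one_mul] using hu₁p_smooth
  have hp₂ : ContDiffOn ℝ ∞ u₂p {p | 1 * p.1.2 ≤ p.2} := by simpa only [one_mul] using hu₂p_smooth
  have hm₁ : ContDiffOn ℝ ∞ u₁m {p | -1 * p.1.2 ≤ p.2} := by
    simpa only [neg_one_mul] using hu₁m_smooth
  have hm₂ : ContDiffOn ℝ ∞ u₂m {p | -1 * p.1.2 ≤ p.2} := by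
    simpa only [neg_one_mul] using hu₂m_smooth
  set vp := pullback 1 u₁p hp₁ - pullback 1 u₂p hp₂
  set vm := pullback (-1) u₂m hm₂ - pullback (-1) u₁m hm₁
  have htotal : ∀ y, ∫ s, q₁ (y, s) = ∫ s, q₂ (y, s) := by
    intro y
    rcases le_or_gt (‖y‖ ^ 2) 1 with hy | hy
    · set z := √(1 - ‖y‖ ^ 2)
      have hz : z ^ 2 = 1 - ‖y‖ ^ 2 := Real.sq_sqrt (by linarith)
      have hz0 : 0 ≤ z := Real.sqrt_nonneg _
      have hfull : ∀ q : Space m → ℝ, (∀ x, 1 < normSq x → q x = 0) →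
          ∫ s in Iic z, q (y, s) = ∫ s, q (y, s) := fun q hq =>
        setIntegral_eq_integral_of_forall_compl_eq_zero fun s hs => hq _ (by
          rw [mem_Iic, not_le] at hs
          rw [normSq_eq]
          dsimp only
          nlinarith)
      have h := hdata_l y z z (by linarith) (by nlinarith) le_rfl
      rw [hu₁p_char, hu₂p_char, hfull q₁ hs₁, hfull q₂ hs₂] at h
      linarith
    · have hzero : ∀ s, 1 < normSq (y, s) := fun s => by
        rw [normSq_eq]
        dsimp only
        nlinarith [sq_nonneg s]
      simp only [hs₁ _ (hzero _), hs₂ _ (hzero _)]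
  have hvp0 : ∀ x, ev (x, 0) vp
      = -(1 / 2) * ((∫ s in Iic x.2, q₁ (x.1, s)) - ∫ s in Iic x.2, q₂ (x.1, s)) := by
    intro x
    rw [map_sub, ev_pullback, ev_pullback]
    dsimp only
    rw [zero_add, one_mul, hu₁p_char x.1 x.2, hu₂p_char x.1 x.2]
    ring
  have hvm0 : ∀ x, ev (x, 0) vm
      = (1 / 2) * ((∫ s in Ici x.2, q₁ (x.1, s)) - ∫ s in Ici x.2, q₂ (x.1, s)) := by
    intro x
    rw [map_sub, ev_pullback, ev_pullback]
    dsimp only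
    rw [zero_add, neg_one_mul, hu₁m_char x.1 x.2, hu₂m_char x.1 x.2]
    ring
  have hslice : ∀ x, ev (x, 0) vp = ev (x, 0) vm := by
    intro x
    rw [hvp0, hvm0]
    linarith [integral_Iic_add_Ici (hi₁ x.1) x.2, integral_Iic_add_Ici (hi₂ x.1) x.2, htotal x.1]
  have hext0 : ∀ x, 1 < normSq x → ev (x, 0) vp = 0 := by
    intro x hx
    have hzero : ∀ (q : Space m → ℝ) (S : Set ℝ), MeasurableSet S →
        (∀ x, 1 < normSq x → q x = 0) → (∀ s ∈ S, x.2 ^ 2 ≤ s ^ 2) →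
        ∫ s in S, q (x.1, s) = 0 := fun q S hS hq h =>
      setIntegral_eq_zero_of_forall_eq_zero fun s hs => hq _ (one_lt_normSq_of_sq_le hx (h s hs))
    rcases le_total x.2 0 with h | h
    · have hS : ∀ s ∈ Iic x.2, x.2 ^ 2 ≤ s ^ 2 := fun s hs => by
        rw [mem_Iic] at hs
        nlinarith
      rw [hvp0, hzero q₁ _ measurableSet_Iic hs₁ hS, hzero q₂ _ measurableSet_Iic hs₂ hS]
      norm_num
    · have hS : ∀ s ∈ Ici x.2, x.2 ^ 2 ≤ s ^ 2 := fun s hs => by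
        rw [mem_Ici] at hs
        nlinarith
      rw [hslice, hvm0, hzero q₁ _ measurableSet_Ici hs₁ hS, hzero q₂ _ measurableSet_Ici hs₂ hS]
      norm_num
  have hderiv : ∀ x, ev (x, 0) (dirD ((0, 1), 0) vp) = -(1 / 2) * (q₁ x - q₂ x) := by
    intro x
    have hmem : ∀ r : ℝ, ((x, 0) : SpaceTime m) + r • ((0, 1), 0) ∈ halfSpace m := fun r => by
      simp [halfSpace]
    have h1 := (hasDerivWithinAt_line vp (x, 0) ((0, 1), 0) (r := 0) (I := univ)
      (fun r _ => hmem r) (hmem 0)).hasDerivAt univ_mem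
    have h2 : (fun r : ℝ => vp.1 ((x, 0) + r • ((0, 1), 0))) = fun r =>
        -(1 / 2) * ((∫ s in Iic (x.2 + r), q₁ (x.1, s)) - ∫ s in Iic (x.2 + r), q₂ (x.1, s)) := by
      funext r
      have e : ((x, 0) : SpaceTime m) + r • ((0, 1), 0) = ((x.1, x.2 + r), 0) := by
        ext <;> simp
      rw [e]
      exact hvp0 (x.1, x.2 + r)
    rw [h2, zero_smul, add_zero] at h1
    have h3 : ∀ q : Space m → ℝ, Continuous q → Integrable (fun s => q (x.1, s)) →
        HasDerivAt (fun r => ∫ s in Iic (x.2 + r), q (x.1, s)) (q x) 0 := fun q hq hi => by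
      have h := hasDerivAt_integral_Iic (f := fun s => q (x.1, s)) (by fun_prop) hi (x.2 + 0)
      have h' := h.comp_const_add x.2 0
      rw [add_zero] at h'
      exact h'
    exact h1.unique (((h3 q₁ hq₁.continuous (hi₁ x.1)).sub
      (h3 q₂ hq₂.continuous (hi₂ x.1))).const_mul _)
  have pde₁p : ∀ p : SpaceTime m, 1 * p.1.2 < p.2 → waveOp m u₁p p + q₁ p.1 * u₁p p = 0 := by
    simpa only [one_mul] using hu₁p_pde
  have pde₂p : ∀ p : SpaceTime m, 1 * p.1.2 < p.2 → waveOp m u₂p p + q₂ p.1 * u₂p p = 0 := by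
    simpa only [one_mul] using hu₂p_pde
  have pde₁m : ∀ p : SpaceTime m, -1 * p.1.2 < p.2 → waveOp m u₁m p + q₁ p.1 * u₁m p = 0 := by
    simpa only [neg_one_mul] using hu₁m_pde
  have pde₂m : ∀ p : SpaceTime m, -1 * p.1.2 < p.2 → waveOp m u₂m p + q₂ p.1 * u₂m p = 0 := by
    simpa only [neg_one_mul] using hu₂m_pde
  have hT0 : 0 < T := by linarith
  have hextp := ev_pullback_sub_eq_zero hp₁ hp₂ (by norm_num) hT0 pde₁p pde₂p hs₁ hs₂
    (fun p h => hu₁p_ic p.1.1 p.1.2 p.2 (by linarith))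
    (fun p h => hu₂p_ic p.1.1 p.1.2 p.2 (by linarith))
    (fun p hx ht h => hdata_l p.1.1 p.1.2 p.2 (normSq_eq p.1 ▸ hx) ht (by linarith)) hext0
  have hextm := ev_pullback_sub_eq_zero hm₂ hm₁ (by norm_num) hT0 pde₂m pde₁m hs₂ hs₁
    (fun p h => hu₂m_ic p.1.1 p.1.2 p.2 (by linarith))
    (fun p h => hu₁m_ic p.1.1 p.1.2 p.2 (by linarith))
    (fun p hx ht h => (hdata_r p.1.1 p.1.2 p.2 (normSq_eq p.1 ▸ hx) ht (by linarith)).symm)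
    (fun x hx => (hslice x).symm.trans (hext0 x hx))
  obtain ⟨Q, hQ⟩ : ∃ Q : smoothAlg m, ∀ p, ev p Q = q₁ p.1 :=
    ⟨⟨fun p => q₁ p.1, (hq₁.comp contDiff_fst).contDiffOn⟩, fun _ => rfl⟩
  funext x
  rcases le_or_gt (normSq x) 1 with hx | hx
  · refine sub_eq_zero.1 (potential_eq_zero hT (Q := Q) (up := pullback 1 u₂p hp₂)
      (um := -pullback (-1) u₂m hm₂) (g := fun x => q₁ x - q₂ x) hslice (fun p hp => ?_)
      (fun p hp => ?_) (fun x _ => hderiv x) hextp hextm hx)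
    · rw [ev_quadOp_pullback_sub hp₁ hp₂ pde₁p pde₂p hp, map_sub, hQ]
      ring
    · rw [ev_quadOp_pullback_sub hm₂ hm₁ pde₂m pde₁m hp, map_sub, map_neg, hQ]
      ring
  · rw [hs₁ x hx, hs₂ x hx]
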